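/- arXiv:1908.00665 — 2 statements merged into one kernel-verified Lean document; each statement's English description precedes it below -/
import Mathlib

section
/- Let G be a connected graph with minimum degree at least h ≥ 2, whose longest cycle C has length 2h, on n ≥ 2h+4 vertices, and let b₁ ≥ b₂ ≥ 1 with b₁ + b₂ = h + 1 and h ≥ 3. If G does not contain the disjoint union P_{2b₁+1} ∪ P_{2b₂+1}, then the induced subgraph on U = V(G)\V(C) contains no path on 3 vertices. -/
open SimpleGraph

/-- `G` embeds into `H` as a (not necessarily induced) subgraph. -/
def SubgraphOf {V W : Type*} (G : SimpleGraph V) (H : SimpleGraph W) : Prop :=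
  ∃ f : V ↪ W, ∀ a b, G.Adj a b → H.Adj (f a) (f b)

/-- `G` contains a linear forest consisting of pairwise vertex-disjoint paths
with orders `L i` (`i : ι`). -/
def ContainsForest {V ι : Type*} (G : SimpleGraph V) (L : ι → ℕ) : Prop :=
  ∃ f : ∀ i, Fin (L i) → V,
    (∀ i, Function.Injective (f i)) ∧
    (∀ i j, i ≠ j → ∀ a b, f i a ≠ f j b) ∧
    (∀ i (a : ℕ) (ha : a + 1 < L i), G.Adj (f i ⟨a, by omega⟩) (f i ⟨a + 1, ha⟩))

/-- `G` is 2-connected: more than 2 vertices and removing fewer than 2 vertices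
leaves a connected graph. -/
def TwoConnected {V : Type*} [Fintype V] (G : SimpleGraph V) : Prop :=
  2 < Fintype.card V ∧
    ∀ s : Finset V, s.card < 2 → (G.induce ((s : Set V)ᶜ)).Connected

/-- `S_{n,h} = K_h ∨ \overline{K_{n-h}}`. -/
def Sgraph (n h : ℕ) : SimpleGraph (Fin n) :=
  SimpleGraph.fromRel (fun a _ => a.val < h)

/-- `S⁺_{n,h} = K_h ∨ (K_2 ∪ \overline{K_{n-h-2}})`, the extra edge joining vertices `h` and `h+1`. -/
def SplusGraph (n h : ℕ) : SimpleGraph (Fin n) :=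
  SimpleGraph.fromRel (fun a b => a.val < h ∨ (a.val ≤ h + 1 ∧ b.val ≤ h + 1))

/-- index of the clique block containing vertex `v ≥ 1` in `K_1 ∨ (t₁ K_h ∪ t₂ K_{h+1})`. -/
def blockIdx (t₁ h v : ℕ) : ℕ :=
  if v - 1 < t₁ * h then (v - 1) / h else t₁ + (v - 1 - t₁ * h) / (h + 1)

/-- `L_{t₁,t₂,h,h+1} = K_1 ∨ (t₁ K_h ∪ t₂ K_{h+1})`; vertex `0` is the center. -/
def Lgen (t₁ t₂ h : ℕ) : SimpleGraph (Fin (t₁ * h + t₂ * (h + 1) + 1)) :=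
  SimpleGraph.fromRel (fun a b =>
    a.val = 0 ∨ blockIdx t₁ h a.val = blockIdx t₁ h b.val)

/-- `U_{3,h}`: three copies of `K_{h+1}` plus a triangle on one chosen vertex of each. -/
def Ugraph (h : ℕ) : SimpleGraph (Fin (3 * (h + 1))) :=
  SimpleGraph.fromRel (fun a b =>
    a.val / (h + 1) = b.val / (h + 1) ∨ (a.val % (h + 1) = 0 ∧ b.val % (h + 1) = 0))

/-- `K_p ∨ (m K_2)`: a clique on the first `p` vertices joined to `m` disjoint edges. -/
def KjoinMK2 (p m : ℕ) : SimpleGraph (Fin (p + 2 * m)) :=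
  SimpleGraph.fromRel (fun a b => a.val < p ∨ (a.val - p) / 2 = (b.val - p) / 2)

/-- `F_{t₁,t₂,h,h+1}`: `L_{t₁,t₂,h,h+1}` plus one extra `K_{h+1}` joined to the center by an edge. -/
def Fgraph (t₁ t₂ h : ℕ) : SimpleGraph (Fin (t₁ * h + (t₂ + 1) * (h + 1) + 1)) :=
  SimpleGraph.fromRel (fun a b =>
    (a.val < t₁ * h + t₂ * (h + 1) + 1 ∧ b.val < t₁ * h + t₂ * (h + 1) + 1 ∧
      (a.val = 0 ∨ blockIdx t₁ h a.val = blockIdx t₁ h b.val)) ∨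
    (t₁ * h + t₂ * (h + 1) + 1 ≤ a.val ∧ t₁ * h + t₂ * (h + 1) + 1 ≤ b.val) ∨
    (a.val = 0 ∧ b.val = t₁ * h + t₂ * (h + 1) + 1))

/-- `T_{t₁,t₂,h,h+1}`: `L_{t₁,t₂,h,h+1}` plus two extra `K_{h+1}`'s, each joined to the center by an edge. -/
def Tgraph (t₁ t₂ h : ℕ) : SimpleGraph (Fin (t₁ * h + (t₂ + 2) * (h + 1) + 1)) :=
  SimpleGraph.fromRel (fun a b =>
    (a.val < t₁ * h + t₂ * (h + 1) + 1 ∧ b.val < t₁ * h + t₂ * (h + 1) + 1 ∧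
      (a.val = 0 ∨ blockIdx t₁ h a.val = blockIdx t₁ h b.val)) ∨
    (t₁ * h + t₂ * (h + 1) + 1 ≤ a.val ∧ a.val < t₁ * h + (t₂ + 1) * (h + 1) + 1 ∧
      t₁ * h + t₂ * (h + 1) + 1 ≤ b.val ∧ b.val < t₁ * h + (t₂ + 1) * (h + 1) + 1) ∨
    (t₁ * h + (t₂ + 1) * (h + 1) + 1 ≤ a.val ∧ t₁ * h + (t₂ + 1) * (h + 1) + 1 ≤ b.val) ∨
    (a.val = 0 ∧ b.val = t₁ * h + t₂ * (h + 1) + 1) ∨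
    (a.val = 0 ∧ b.val = t₁ * h + (t₂ + 1) * (h + 1) + 1))

/-- attach a pendant path with `m` additional vertices at the vertex `u` of `H`
(i.e. identify `u` with an endpoint of `P_{m+1}`). -/
def attachPath {V : Type*} (H : SimpleGraph V) (u : V) (m : ℕ) : SimpleGraph (V ⊕ Fin m) :=
  SimpleGraph.fromRel (fun a b =>
    (∃ x y, a = Sum.inl x ∧ b = Sum.inl y ∧ H.Adj x y) ∨
    (∃ j : Fin m, a = Sum.inl u ∧ b = Sum.inr j ∧ j.val = 0) ∨
    (∃ i j : Fin m, a = Sum.inr i ∧ b = Sum.inr j ∧ j.val = i.val + 1))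

structure Cx {V : Type*} (G : SimpleGraph V) (h b₁ b₂ : ℕ) (γ : ℕ → V) : Prop where
  adj : ∀ i, G.Adj (γ i) (γ (i + 1))
  per : ∀ i, γ (i + 2 * h) = γ i
  inj : ∀ i j, i < j → j < i + 2 * h → γ i ≠ γ j
  long : ∀ (a : V) (l : List V) (e : V), (a :: l ++ [e]).IsChain G.Adj → (a :: l ++ [e]).Nodup →
    1 ≤ l.length → G.Adj e a → l.length + 2 ≤ 2 * h
  nofor : ∀ l₁ l₂ : List V, l₁.IsChain G.Adj → l₂.IsChain G.Adj → (l₁ ++ l₂).Nodup →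
    l₁.length = 2 * b₁ + 1 → l₂.length = 2 * b₂ + 1 → False

theorem Cx.rot {V : Type*} {G : SimpleGraph V} {h b₁ b₂ : ℕ} {γ : ℕ → V}
    (X : Cx G h b₁ b₂ γ) (s : ℕ) : Cx G h b₁ b₂ (fun i => γ (s + i)) where
  adj i := X.adj (s + i)
  per i := by simpa [add_assoc] using X.per (s + i)
  inj i j h1 h2 := X.inj _ _ (by omega) (by omega)
  long := X.long
  nofor := X.nofor

def arc {V : Type*} (γ : ℕ → V) (s k : ℕ) : List V := (List.range k).map (fun i => γ (s + i))

theorem Cx.arc_chain {V : Type*} {G : SimpleGraph V} {h b₁ b₂ : ℕ} {γ : ℕ → V}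
    (X : Cx G h b₁ b₂ γ) (s k : ℕ) : (arc γ s k).IsChain G.Adj := by
  rw [List.isChain_iff_getElem]
  intro i hi
  simpa [arc, add_assoc] using X.adj (s + i)

theorem Cx.arc_nodup {V : Type*} {G : SimpleGraph V} {h b₁ b₂ : ℕ} {γ : ℕ → V}
    (X : Cx G h b₁ b₂ γ) (s k : ℕ) (hk : k ≤ 2 * h) : (arc γ s k).Nodup := by
  unfold arc
  refine List.Nodup.map_on ?_ List.nodup_range
  intro x hx y hy hxy
  simp only [List.mem_range] at hx hy
  rcases lt_trichotomy x y with hl | hl | hl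
  · exact absurd hxy (X.inj _ _ (by omega) (by omega))
  · exact hl
  · exact absurd hxy.symm (X.inj _ _ (by omega) (by omega))

theorem Cx.app_arc {V : Type*} {G : SimpleGraph V} {h b₁ b₂ : ℕ} {γ : ℕ → V}
    (X : Cx G h b₁ b₂ γ) (l : List V) (s k : ℕ) (hk : k ≤ 2 * h)
    (hc : (l ++ [γ s]).IsChain G.Adj) (hn : l.Nodup) (ho : ∀ a ∈ l, ∀ i, a ≠ γ i) :
    (l ++ arc γ s k).IsChain G.Adj ∧ (l ++ arc γ s k).Nodup := by
  constructor
  · rw [List.isChain_append] at hc ⊢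
    refine ⟨hc.1, X.arc_chain s k, ?_⟩
    intro x hx y hy
    apply hc.2.2 x hx
    cases k with
    | zero => simp [arc] at hy
    | succ k => simpa [arc, List.range_succ_eq_map] using hy
  · rw [List.nodup_append]
    refine ⟨hn, X.arc_nodup s k hk, ?_⟩
    intro a ha b hb
    simp only [arc, List.mem_map] at hb
    obtain ⟨i, -, rfl⟩ := hb
    exact ho a ha _

theorem Cx.gap {V : Type*} {G : SimpleGraph V} {h b₁ b₂ : ℕ} {γ : ℕ → V}
    (X : Cx G h b₁ b₂ γ) (hh : 3 ≤ h) (a : V) (l : List V) (i j : ℕ) (hl : l.length ≤ 2)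
    (hc : (a :: l ++ [γ j]).IsChain G.Adj) (hn : (a :: l).Nodup)
    (ho : ∀ b ∈ a :: l, ∀ i, b ≠ γ i) (hi : G.Adj a (γ i)) (hij : i < j) :
    i + l.length + 2 ≤ j := by
  by_contra hcon
  obtain ⟨k, hk⟩ : ∃ k, j + k = i + 2 * h := ⟨i + 2 * h - j, by omega⟩
  have := X.app_arc (a :: l) j (k + 1) (by omega) hc hn ho
  have he : (a :: l ++ arc γ j (k + 1)) = a :: (l ++ arc γ j k) ++ [γ i] := by
    simp [arc, List.range_succ, hk, X.per]
  rw [he] at this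
  have h2 := X.long a _ (γ i) this.1 this.2 (by simp [arc]; omega) hi.symm
  simp [arc] at h2
  omega

theorem Cx.nolong {V : Type*} {G : SimpleGraph V} {h b₁ b₂ : ℕ} {γ : ℕ → V}
    (X : Cx G h b₁ b₂ γ) (hsum : b₁ + b₂ = h + 1) (l : List V) (hc : l.IsChain G.Adj)
    (hn : l.Nodup) (hl : l.length = 2 * h + 4) : False := by
  refine X.nofor (l.take (2 * b₁ + 1)) (l.drop (2 * b₁ + 1)) (hc.take _) (hc.drop _) ?_ ?_ ?_
  · simpa using hn
  · simp; omega
  · simp; omega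

theorem Cx.no4 {V : Type*} {G : SimpleGraph V} {h b₁ b₂ : ℕ} {γ : ℕ → V}
    (X : Cx G h b₁ b₂ γ) (hsum : b₁ + b₂ = h + 1) (d c b a : V) (i : ℕ)
    (hc : [d, c, b, a].IsChain G.Adj) (hai : G.Adj a (γ i))
    (hn : [d, c, b, a].Nodup) (ho : ∀ x ∈ [d, c, b, a], ∀ i, x ≠ γ i) : False := by
  have := X.app_arc [d, c, b, a] i (2 * h) le_rfl (by simp at hc ⊢; tauto) hn ho
  exact X.nolong hsum _ this.1 this.2 (by simp [arc]; try omega)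

/-- neighbours of the end of a 3-path -/
theorem Cx.endn {V : Type*} {G : SimpleGraph V} {h b₁ b₂ : ℕ} {γ : ℕ → V}
    (X : Cx G h b₁ b₂ γ) (hsum : b₁ + b₂ = h + 1) (x y z w : V) (i : ℕ)
    (hxy : G.Adj x y) (hyz : G.Adj y z) (hxz : x ≠ z) (hxi : G.Adj x (γ i))
    (hx : ∀ i, x ≠ γ i) (hy : ∀ i, y ≠ γ i) (hz : ∀ i, z ≠ γ i) (hw : ∀ i, w ≠ γ i)
    (hzw : G.Adj z w) : w = x ∨ w = y := by
  by_contra hcon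
  push Not at hcon
  refine X.no4 hsum w z y x i ?_ hxi ?_ ?_
  · simp [hzw.symm, hyz.symm, hxy.symm]
  · simp [hzw.ne', hyz.ne', hxy.ne', hcon, hxz.symm]
  · simp; exact ⟨hw, hz, hy, hx⟩

open Classical in
noncomputable def Sset {V : Type*} (G : SimpleGraph V) (h : ℕ) (γ : ℕ → V) (x : V) : Finset ℕ :=
  (Finset.range (2 * h)).filter (fun i => G.Adj x (γ i))

theorem deg_le {V : Type*} [Fintype V] [DecidableEq V] {G : SimpleGraph V} [DecidableRel G.Adj]
    {h b₁ b₂ : ℕ} {γ : ℕ → V} (X : Cx G h b₁ b₂ γ) (hh : 3 ≤ h) (x : V) (hd : h ≤ G.degree x)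
    (T : Finset V) (hT : ∀ w, G.Adj x w → (∀ i, w ≠ γ i) → w ∈ T) :
    h ≤ T.card + (Sset G h γ x).card := by
  have hmod : ∀ i, γ (i % (2 * h)) = γ i := fun i =>
    Function.Periodic.map_mod_nat (f := γ) X.per i
  have : G.neighborFinset x ⊆ T ∪ (Sset G h γ x).image γ := by
    intro w hw
    rw [SimpleGraph.mem_neighborFinset] at hw
    rw [Finset.mem_union]
    by_cases hc : ∀ i, w ≠ γ i
    · exact Or.inl (hT w hw hc)
    · push Not at hc
      obtain ⟨i, rfl⟩ := hc
      right
      rw [Finset.mem_image]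
      refine ⟨i % (2 * h), ?_, hmod i⟩
      simp only [Sset, Finset.mem_filter, Finset.mem_range]
      exact ⟨Nat.mod_lt _ (by omega), by rwa [hmod]⟩
  have h1 := Finset.card_le_card this
  have h2 := Finset.card_union_le T ((Sset G h γ x).image γ)
  have h3 := Finset.card_image_le (s := Sset G h γ x) (f := γ)
  rw [SimpleGraph.card_neighborFinset_eq_degree] at h1
  omega

theorem spaced (S : Finset ℕ) (h k : ℕ) (hk : 0 < k) (hS : ∀ i ∈ S, 4 ≤ i ∧ i + 4 ≤ 2 * h)
    (hs : ∀ i ∈ S, ∀ j ∈ S, i < j → i + k ≤ j) :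
    S.card ≤ (2 * h - 4) / k + 1 - 4 / k := by
  have : S.card ≤ (Finset.Icc (4 / k) ((2 * h - 4) / k)).card := by
    apply Finset.card_le_card_of_injOn (fun i => i / k)
    · intro i hi
      have := hS i hi
      simp only [Finset.coe_Icc, Set.mem_Icc]
      exact ⟨Nat.div_le_div_right this.1, Nat.div_le_div_right (by omega)⟩
    · intro i hi j hj hij
      simp only at hij
      have key : ∀ a b : ℕ, a + k ≤ b → a / k < b / k := by
        intro a b hab
        have := Nat.div_le_div_right (c := k) hab
        rw [Nat.add_div_right _ hk] at this
        omega
      rcases lt_trichotomy i j with hl | hl | hl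
      · have := key _ _ (hs i hi j hj hl); omega
      · exact hl
      · have := key _ _ (hs j hj i hi hl); omega
  simpa using this

theorem Cx.mem0 {V : Type*} {G : SimpleGraph V} {h b₁ b₂ : ℕ} {γ : ℕ → V}
    (X : Cx G h b₁ b₂ γ) (hh : 3 ≤ h) (x y z : V)
    (hxy : G.Adj x y) (hyz : G.Adj y z) (hxz : x ≠ z) (hx0 : G.Adj x (γ 0))
    (hx : ∀ i, x ≠ γ i) (hy : ∀ i, y ≠ γ i) (hz : ∀ i, z ≠ γ i) :
    ∀ i ∈ (Sset G h γ z).erase 0, 4 ≤ i ∧ i + 4 ≤ 2 * h := by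
  intro i hi
  simp only [Sset, Finset.mem_erase, Finset.mem_filter, Finset.mem_range] at hi
  obtain ⟨hi0, hi1, hi2⟩ := hi
  constructor
  · have := X.gap hh x [y, z] 0 i (by simp) (by simp [hxy, hyz, hi2])
      (by simp [hxy.ne, hyz.ne, hxz]) (by simp; exact ⟨hx, hy, hz⟩) hx0 (by omega)
    simpa using this
  · have hx1 : G.Adj x (γ (2 * h)) := by
      have := X.per 0
      rw [zero_add] at this
      rwa [this]
    have := X.gap hh z [y, x] i (2 * h) (by simp) (by simp [hxy.symm, hyz.symm, hx1])
      (by simp [hxy.ne', hyz.ne', hxz.symm]) (by simp; exact ⟨hz, hy, hx⟩) hi2 (by omega)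
    simpa using this

theorem Cx.sp2 {V : Type*} {G : SimpleGraph V} {h b₁ b₂ : ℕ} {γ : ℕ → V}
    (X : Cx G h b₁ b₂ γ) (hh : 3 ≤ h) (z : V) (hz : ∀ i, z ≠ γ i) (i j : ℕ) (hi : G.Adj z (γ i))
    (hj : G.Adj z (γ j)) (hij : i < j) : i + 2 ≤ j := by
  simpa using X.gap hh z [] i j (by simp) (by simp [hj]) (by simp) (by simpa using hz) hi hij

theorem Cx.card0 {V : Type*} {G : SimpleGraph V} {h b₁ b₂ : ℕ} {γ : ℕ → V}
    (X : Cx G h b₁ b₂ γ) (hh : 3 ≤ h) (x y z : V)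
    (hxy : G.Adj x y) (hyz : G.Adj y z) (hxz : x ≠ z) (hx0 : G.Adj x (γ 0))
    (hx : ∀ i, x ≠ γ i) (hy : ∀ i, y ≠ γ i) (hz : ∀ i, z ≠ γ i) :
    ((Sset G h γ z).erase 0).card ≤ h - 3 := by
  have := spaced _ h 2 (by omega) (X.mem0 hh x y z hxy hyz hxz hx0 hx hy hz) (by
    intro i hi j hj hij
    simp only [Sset, Finset.mem_erase, Finset.mem_filter, Finset.mem_range] at hi hj
    exact X.sp2 hh z hz i j hi.2.2 hj.2.2 hij)
  omega

theorem Cx.star {V : Type*} [Fintype V] [DecidableEq V] {G : SimpleGraph V} [DecidableRel G.Adj]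
    {h b₁ b₂ : ℕ} {γ : ℕ → V}
    (X : Cx G h b₁ b₂ γ) (hh : 3 ≤ h) (hδ : ∀ v, h ≤ G.degree v) (x y z : V) (i : ℕ)
    (hxy : G.Adj x y) (hyz : G.Adj y z) (hxz : x ≠ z) (hxi : G.Adj x (γ i))
    (hx : ∀ i, x ≠ γ i) (hy : ∀ i, y ≠ γ i) (hz : ∀ i, z ≠ γ i)
    (hzn : ∀ w, G.Adj z w → (∀ i, w ≠ γ i) → w = y) : False := by
  have X' := X.rot i
  have h1 := deg_le X' hh z (hδ z) {y} (by
    intro w hw ho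
    rw [Finset.mem_singleton]
    apply hzn w hw
    intro j
    have := ho (j + 2 * h * i - i)
    have e : γ (i + (j + 2 * h * i - i)) = γ j := by
      have : i + (j + 2 * h * i - i) = j + i * (2 * h) := by
        have : i ≤ 2 * h * i := by nlinarith
        have e2 : 2 * h * i = i * (2 * h) := by ring
        omega
      rw [this]
      exact Function.Periodic.nat_mul (f := γ) (c := 2 * h) X.per i j
    simpa [e] using this)
  have h2 := X'.card0 hh x y z hxy hyz hxz hxi (fun _ => hx _) (fun _ => hy _) (fun _ => hz _)
  have h3 := Finset.pred_card_le_card_erase (s := Sset G h (fun k => γ (i + k)) z) (a := 0)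
  simp at h1
  omega

theorem Cx.tri0 {V : Type*} [Fintype V] [DecidableEq V] {G : SimpleGraph V} [DecidableRel G.Adj]
    {h b₁ b₂ : ℕ} {γ : ℕ → V}
    (X : Cx G h b₁ b₂ γ) (hh : 3 ≤ h) (hδ : ∀ v, h ≤ G.degree v) (x y z : V) (i : ℕ)
    (hxy : G.Adj x y) (hyz : G.Adj y z) (hxz : x ≠ z) (hxi : G.Adj x (γ i))
    (hx : ∀ i, x ≠ γ i) (hy : ∀ i, y ≠ γ i) (hz : ∀ i, z ≠ γ i)
    (hzn : ∀ w, G.Adj z w → (∀ i, w ≠ γ i) → w = x ∨ w = y) : G.Adj z (γ i) := by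
  have X' := X.rot i
  have h1 := deg_le X' hh z (hδ z) {x, y} (by
    intro w hw ho
    rw [Finset.mem_insert, Finset.mem_singleton]
    apply hzn w hw
    intro j
    have := ho (j + 2 * h * i - i)
    have e : γ (i + (j + 2 * h * i - i)) = γ j := by
      have : i + (j + 2 * h * i - i) = j + i * (2 * h) := by
        have : i ≤ 2 * h * i := by nlinarith
        have e2 : 2 * h * i = i * (2 * h) := by ring
        omega
      rw [this]
      exact Function.Periodic.nat_mul (f := γ) (c := 2 * h) X.per i j
    simpa [e] using this)
  have h2 := X'.card0 hh x y z hxy hyz hxz hxi (fun _ => hx _) (fun _ => hy _) (fun _ => hz _)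
  have h4 := Finset.card_le_two (a := x) (b := y)
  by_contra hcon
  rw [Finset.erase_eq_of_notMem (by simpa [Sset] using fun _ => hcon)] at h2
  omega

theorem Cx.tri {V : Type*} [Fintype V] [DecidableEq V] {G : SimpleGraph V} [DecidableRel G.Adj]
    {h b₁ b₂ : ℕ} {γ : ℕ → V}
    (X : Cx G h b₁ b₂ γ) (hh : 3 ≤ h) (hδ : ∀ v, h ≤ G.degree v) (x y z : V)
    (hxy : G.Adj x y) (hyz : G.Adj y z) (hxz : x ≠ z) (hx0 : G.Adj x (γ 0))
    (hx : ∀ i, x ≠ γ i) (hy : ∀ i, y ≠ γ i) (hz : ∀ i, z ≠ γ i)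
    (hxn : ∀ w, G.Adj x w → (∀ i, w ≠ γ i) → w = y ∨ w = z)
    (hzn : ∀ w, G.Adj z w → (∀ i, w ≠ γ i) → w = x ∨ w = y) :
    h ≤ 4 ∧ (h = 4 → G.Adj x (γ 4)) := by
  have hz0 := X.tri0 hh hδ x y z 0 hxy hyz hxz hx0 hx hy hz hzn
  have hm := X.mem0 hh z y x hyz.symm hxy.symm hxz.symm hz0 hz hy hx
  have h1 := deg_le X hh x (hδ x) {y, z} (by
    intro w hw ho
    rw [Finset.mem_insert, Finset.mem_singleton]
    exact hxn w hw ho)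
  have h4 := Finset.card_le_two (a := y) (b := z)
  have h3 := Finset.pred_card_le_card_erase (s := Sset G h γ x) (a := 0)
  have h2 := spaced _ h 4 (by omega) hm (by
    intro i hi j hj hij
    simp only [Sset, Finset.mem_erase, Finset.mem_filter, Finset.mem_range] at hi hj
    have hzi := X.tri0 hh hδ x y z i hxy hyz hxz hi.2.2 hx hy hz hzn
    have := X.gap hh z [y, x] i j (by simp) (by simp [hxy.symm, hyz.symm, hj.2.2])
      (by simp [hxy.ne', hyz.ne', hxz.symm]) (by simp; exact ⟨hz, hy, hx⟩) hzi hij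
    simpa using this)
  refine ⟨by omega, ?_⟩
  rintro rfl
  have : 0 < ((Sset G 4 γ x).erase 0).card := by omega
  obtain ⟨i, hi⟩ := Finset.card_pos.1 this
  have := hm i hi
  obtain rfl : i = 4 := by omega
  simp only [Sset, Finset.mem_erase, Finset.mem_filter, Finset.mem_range] at hi
  exact hi.2.2

theorem Cx.hne {V : Type*} {G : SimpleGraph V} {h b₁ b₂ : ℕ} {γ : ℕ → V}
    (X : Cx G h b₁ b₂ γ) (i j : ℕ) (hi : i < 2 * h) (hj : j < 2 * h) : γ i = γ j ↔ i = j := by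
  constructor
  · intro hxy
    rcases lt_trichotomy i j with hl | hl | hl
    · exact absurd hxy (X.inj _ _ (by omega) (by omega))
    · exact hl
    · exact absurd hxy.symm (X.inj _ _ (by omega) (by omega))
  · rintro rfl; rfl

theorem fin3 {V : Type*} {G : SimpleGraph V} {γ : ℕ → V}
    (X : Cx G 3 2 2 γ) (x y z u : V) (i : ℕ)
    (hxy : G.Adj x y) (hyz : G.Adj y z) (hxz : x ≠ z) (hz0 : G.Adj z (γ 0))
    (hx : ∀ i, x ≠ γ i) (hy : ∀ i, y ≠ γ i) (hz : ∀ i, z ≠ γ i) (hu : ∀ i, u ≠ γ i)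
    (hux : u ≠ x) (huy : u ≠ y) (huz : u ≠ z) (hui : G.Adj u (γ i)) (hi : i < 6) : i = 3 := by
  have hxy' := hxy.ne
  have hyz' := hyz.ne
  have hx' := fun i => (hx i).symm
  have hy' := fun i => (hy i).symm
  have hz' := fun i => (hz i).symm
  have hu' := fun i => (hu i).symm
  have hne := X.hne
  have a0 : G.Adj (γ 0) (γ 1) := X.adj 0
  have a1 : G.Adj (γ 1) (γ 2) := X.adj 1
  have a2 : G.Adj (γ 2) (γ 3) := X.adj 2
  have a3 : G.Adj (γ 3) (γ 4) := X.adj 3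
  have a4 : G.Adj (γ 4) (γ 5) := X.adj 4
  have a5 : G.Adj (γ 0) (γ 5) := by
    have := X.adj 5
    have e := X.per 0
    simp at e this
    rw [e] at this
    exact this.symm
  by_contra hi3
  have key : ∀ l₁ l₂ : List V, l₁.IsChain G.Adj → l₂.IsChain G.Adj → (l₁ ++ l₂).Nodup →
    l₁.length = 5 → l₂.length = 5 → False := X.nofor
  interval_cases i
  · exact key [x, y, z, γ 0, u] [γ 1, γ 2, γ 3, γ 4, γ 5] (by simp [*, hui.symm]) (by simp [*])
      (by simp [*, huz.symm, hux.symm, huy.symm]) rfl rfl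
  · exact key [x, y, z, γ 0, γ 5] [u, γ 1, γ 2, γ 3, γ 4] (by simp [*]) (by simp [*])
      (by simp [*, huz.symm, hux.symm, huy.symm]) rfl rfl
  · exact key [x, y, z, γ 0, γ 1] [u, γ 2, γ 3, γ 4, γ 5] (by simp [*]) (by simp [*])
      (by simp [*, huz.symm, hux.symm, huy.symm]) rfl rfl
  · exact hi3 rfl
  · exact key [x, y, z, γ 0, γ 5] [u, γ 4, γ 3, γ 2, γ 1] (by simp [*]) (by simp [*, a1.symm, a2.symm, a3.symm])
      (by simp [*, huz.symm, hux.symm, huy.symm]) rfl rfl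
  · exact key [x, y, z, γ 0, γ 1] [u, γ 5, γ 4, γ 3, γ 2] (by simp [*]) (by simp [*, a2.symm, a3.symm, a4.symm])
      (by simp [*, huz.symm, hux.symm, huy.symm]) rfl rfl

theorem fin4 {V : Type*} {G : SimpleGraph V} {γ : ℕ → V}
    (X : Cx G 4 3 2 γ) (x y z u : V) (i : ℕ)
    (hxy : G.Adj x y) (hyz : G.Adj y z) (hxz : x ≠ z) (hz0 : G.Adj z (γ 0))
    (hz4 : G.Adj z (γ 4))
    (hx : ∀ i, x ≠ γ i) (hy : ∀ i, y ≠ γ i) (hz : ∀ i, z ≠ γ i) (hu : ∀ i, u ≠ γ i)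
    (hux : u ≠ x) (huy : u ≠ y) (huz : u ≠ z) (hui : G.Adj u (γ i)) (hi : i < 8) : False := by
  have hxy' := hxy.ne
  have hyz' := hyz.ne
  have hx' := fun i => (hx i).symm
  have hy' := fun i => (hy i).symm
  have hz' := fun i => (hz i).symm
  have hu' := fun i => (hu i).symm
  have hne := X.hne
  have a0 : G.Adj (γ 0) (γ 1) := X.adj 0
  have a1 : G.Adj (γ 1) (γ 2) := X.adj 1
  have a2 : G.Adj (γ 2) (γ 3) := X.adj 2
  have a3 : G.Adj (γ 3) (γ 4) := X.adj 3
  have a4 : G.Adj (γ 4) (γ 5) := X.adj 4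
  have a5 : G.Adj (γ 5) (γ 6) := X.adj 5
  have a6 : G.Adj (γ 6) (γ 7) := X.adj 6
  have a7 : G.Adj (γ 7) (γ 0) := by
    have := X.adj 7
    have e := X.per 0
    simp at e this
    rwa [e] at this
  have s0 := a0.symm
  have s1 := a1.symm
  have s2 := a2.symm
  have s3 := a3.symm
  have s4 := a4.symm
  have s5 := a5.symm
  have s6 := a6.symm
  have s7 := a7.symm
  have key : ∀ l₂ l₁ : List V, l₁.IsChain G.Adj → l₂.IsChain G.Adj → (l₁ ++ l₂).Nodup →
    l₁.length = 7 → l₂.length = 5 → False := fun _ _ => X.nofor _ _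
  interval_cases i
  · exact key [x, y, z, γ 0, u] [γ 1, γ 2, γ 3, γ 4, γ 5, γ 6, γ 7] (by simp [*])
      (by simp [*, hui.symm]) (by simp [*, huz.symm, hux.symm, huy.symm]) rfl rfl
  · exact key [x, y, z, γ 0, γ 7] [u, γ 1, γ 2, γ 3, γ 4, γ 5, γ 6] (by simp [*])
      (by simp [*]) (by simp [*, huz.symm, hux.symm, huy.symm]) rfl rfl
  · exact key [x, y, z, γ 0, γ 1] [u, γ 2, γ 3, γ 4, γ 5, γ 6, γ 7] (by simp [*])
      (by simp [*]) (by simp [*, huz.symm, hux.symm, huy.symm]) rfl rfl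
  · exact key [x, y, z, γ 4, γ 5] [u, γ 3, γ 2, γ 1, γ 0, γ 7, γ 6] (by simp [*])
      (by simp [*]) (by simp [*, huz.symm, hux.symm, huy.symm]) rfl rfl
  · exact key [x, y, z, γ 4, u] [γ 5, γ 6, γ 7, γ 0, γ 1, γ 2, γ 3] (by simp [*])
      (by simp [*, hui.symm]) (by simp [*, huz.symm, hux.symm, huy.symm]) rfl rfl
  · exact key [x, y, z, γ 4, γ 3] [u, γ 5, γ 6, γ 7, γ 0, γ 1, γ 2] (by simp [*])
      (by simp [*]) (by simp [*, huz.symm, hux.symm, huy.symm]) rfl rfl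
  · exact key [x, y, z, γ 0, γ 7] [u, γ 6, γ 5, γ 4, γ 3, γ 2, γ 1] (by simp [*])
      (by simp [*]) (by simp [*, huz.symm, hux.symm, huy.symm]) rfl rfl
  · exact key [x, y, z, γ 0, γ 1] [u, γ 7, γ 6, γ 5, γ 4, γ 3, γ 2] (by simp [*])
      (by simp [*]) (by simp [*, huz.symm, hux.symm, huy.symm]) rfl rfl

theorem third {V : Type*} [Fintype V] [DecidableEq V] {G : SimpleGraph V} [DecidableRel G.Adj]
    (x a b : V) (hd : 3 ≤ G.degree x) : ∃ w, G.Adj x w ∧ w ≠ a ∧ w ≠ b := by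
  have h4 := Finset.card_le_two (a := a) (b := b)
  obtain ⟨w, hw, hn⟩ := Finset.exists_mem_notMem_of_card_lt_card
    (s := {a, b}) (t := G.neighborFinset x) (by
      rw [SimpleGraph.card_neighborFinset_eq_degree]; omega)
  simp at hw hn
  exact ⟨w, hw, hn⟩

theorem bdry {V : Type*} {G : SimpleGraph V} (hconn : G.Connected) (S : Set V) (u v : V)
    (hu : u ∈ S) (hv : v ∉ S) : ∃ a b, G.Adj a b ∧ a ∈ S ∧ b ∉ S := by
  obtain ⟨p⟩ := hconn.preconnected u v
  obtain ⟨d, -, h1, h2⟩ := p.exists_boundary_dart S hu hv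
  exact ⟨d.fst, d.snd, d.adj, h1, h2⟩

/-- the triangle case, rotated -/
theorem Cx.trifin {V : Type*} [Fintype V] [DecidableEq V] {G : SimpleGraph V} [DecidableRel G.Adj]
    {h b₁ b₂ : ℕ} {γ : ℕ → V} (X : Cx G h b₁ b₂ γ) (hb : b₂ ≤ b₁) (hb1 : 1 ≤ b₂)
    (hsum : b₁ + b₂ = h + 1) (hh : 3 ≤ h) (hconn : G.Connected)
    (hcard : 2 * h + 4 ≤ Fintype.card V) (hδ : ∀ v, h ≤ G.degree v) (x y z : V)
    (hxy : G.Adj x y) (hyz : G.Adj y z) (hxz : x ≠ z) (hx0 : G.Adj x (γ 0))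
    (hx : ∀ i, x ≠ γ i) (hy : ∀ i, y ≠ γ i) (hz : ∀ i, z ≠ γ i)
    (hxn : ∀ w, G.Adj x w → (∀ i, w ≠ γ i) → w = y ∨ w = z)
    (hyn : ∀ w, G.Adj y w → (∀ i, w ≠ γ i) → w = x ∨ w = z)
    (hzn : ∀ w, G.Adj z w → (∀ i, w ≠ γ i) → w = x ∨ w = y) : False := by
  obtain ⟨h4, h44⟩ := X.tri hh hδ x y z hxy hyz hxz hx0 hx hy hz hxn hzn
  have hmod : ∀ i, γ (i % (2 * h)) = γ i := fun i =>
    Function.Periodic.map_mod_nat (f := γ) X.per i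
  set K : Set V := {w | (∀ i, w ≠ γ i) ∧ w ≠ x ∧ w ≠ y ∧ w ≠ z} with hK
  have hKn : ∀ a b, a ∈ K → G.Adj a b → (∀ i, b ≠ γ i) → b ∈ K := by
    intro a b ha hab hbo
    refine ⟨hbo, ?_, ?_, ?_⟩
    · rintro rfl; have := hxn a hab.symm ha.1; have := ha.2; tauto
    · rintro rfl; have := hyn a hab.symm ha.1; have := ha.2; tauto
    · rintro rfl; have := hzn a hab.symm ha.1; have := ha.2; tauto
  obtain ⟨u₀, hu₀⟩ : ∃ u, u ∈ K := by
    by_contra hcon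
    push Not at hcon
    have : (Finset.univ : Finset V) ⊆ (Finset.range (2 * h)).image γ ∪ {x, y, z} := by
      intro w _
      have := hcon w
      by_contra hw
      apply this
      simp at hw
      refine ⟨?_, hw.1, hw.2.1, hw.2.2.1⟩
      intro i hi
      exact hw.2.2.2 (i % (2 * h)) (Nat.mod_lt _ (by omega)) (by rw [hmod, hi])
    have h1 := Finset.card_le_card this
    have h2 := Finset.card_union_le ((Finset.range (2 * h)).image γ) {x, y, z}
    have h3 := Finset.card_image_le (s := Finset.range (2 * h)) (f := γ)
    have h5 := Finset.card_le_three (a := x) (b := y) (c := z)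
    rw [Finset.card_univ] at h1
    simp only [Finset.card_range] at h3
    omega
  obtain ⟨u, w, huw, huK, hwK⟩ := bdry hconn K u₀ x hu₀ (by simp [hK])
  have hwo : ¬ ∀ i, w ≠ γ i := fun hw => hwK (hKn u w huK huw hw)
  push Not at hwo
  obtain ⟨i, rfl⟩ := hwo
  by_cases hb2 : b₂ = 1
  · subst hb2
    have := X.app_arc [u] i (2 * h) le_rfl (by simp [huw]) (by simp) (by simpa using huK.1)
    refine X.nofor _ [x, y, z] this.1 (by simp [hxy, hyz]) ?_ (by simp [arc]; omega) (by simp)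
    rw [List.nodup_append]
    refine ⟨this.2, by simp [hxy.ne, hyz.ne, hxz], ?_⟩
    intro a ha b hb
    rw [List.mem_append, List.mem_singleton] at ha
    rcases ha with rfl | ha
    · simp at hb
      rcases hb with rfl | rfl | rfl
      · exact huK.2.1
      · exact huK.2.2.1
      · exact huK.2.2.2
    · simp only [arc, List.mem_map] at ha
      obtain ⟨j, -, rfl⟩ := ha
      simp at hb
      rcases hb with rfl | rfl | rfl
      · exact (hx _).symm
      · exact (hy _).symm
      · exact (hz _).symm
  obtain rfl | rfl : h = 3 ∨ h = 4 := by omega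
  · obtain rfl : b₁ = 2 := by omega
    obtain rfl : b₂ = 2 := by omega
    have f3 : ∀ u ∈ K, ∀ i, G.Adj u (γ i) → γ i = γ 3 := by
      intro u hu i hi
      have := fin3 X z y x u (i % 6) hyz.symm hxy.symm hxz.symm hx0 hz hy hx hu.1 hu.2.2.2
        hu.2.2.1 hu.2.1 (by rw [hmod i]; exact hi) (Nat.mod_lt _ (by omega))
      rw [← this]; exact (hmod i).symm
    have hu3 : G.Adj u (γ 3) := by rw [← f3 u huK i huw]; exact huw
    obtain ⟨u₁, hu₁, hu₁3, -⟩ := third u (γ 3) (γ 3) (hδ u)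
    have hu₁K : u₁ ∈ K := hKn u u₁ huK hu₁ (by
      rintro j rfl
      exact hu₁3 (f3 u huK j hu₁))
    obtain ⟨u₂, hu₂, hu₂3, hu₂u⟩ := third u₁ (γ 3) u (hδ u₁)
    have hu₂K : u₂ ∈ K := hKn u₁ u₂ hu₁K hu₂ (by
      rintro j rfl
      exact hu₂3 (f3 u₁ hu₁K j hu₂))
    have a0 : G.Adj (γ 0) (γ 1) := X.adj 0
    have a2 : G.Adj (γ 3) (γ 2) := (X.adj 2).symm
    obtain ⟨k1, k2, k3, k4⟩ := huK
    obtain ⟨l1, l2, l3, l4⟩ := hu₁K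
    obtain ⟨m1, m2, m3, m4⟩ := hu₂K
    have hne := X.hne
    refine X.nofor [u₂, u₁, u, γ 3, γ 2] [z, y, x, γ 0, γ 1] ?_ ?_ ?_ rfl rfl
    · simp [hu₂.symm, hu₁.symm, hu3, a2]
    · simp [hyz.symm, hxy.symm, hx0, a0]
    · have hx' := fun i => (hx i).symm
      have hy' := fun i => (hy i).symm
      have hz' := fun i => (hz i).symm
      simp [*, hu₂.ne', hu₁.ne', hyz.ne', hxy.ne', hxz.symm]
  · obtain rfl : b₁ = 3 := by omega
    obtain rfl : b₂ = 2 := by omega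
    exact fin4 X z y x u (i % 8) hyz.symm hxy.symm hxz.symm hx0 (h44 rfl) hz hy hx huK.1 huK.2.2.2
        huK.2.2.1 huK.2.1 (by rw [hmod i]; exact huw) (Nat.mod_lt _ (by omega))

theorem Cx.main {V : Type*} [Fintype V] [DecidableEq V] {G : SimpleGraph V} [DecidableRel G.Adj]
    {h b₁ b₂ : ℕ} {γ : ℕ → V} (X : Cx G h b₁ b₂ γ) (hb : b₂ ≤ b₁) (hb1 : 1 ≤ b₂)
    (hsum : b₁ + b₂ = h + 1) (hh : 3 ≤ h) (hconn : G.Connected)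
    (hcard : 2 * h + 4 ≤ Fintype.card V) (hδ : ∀ v, h ≤ G.degree v) (p q r : V)
    (hpq : G.Adj p q) (hqr : G.Adj q r) (hpr : p ≠ r)
    (hp : ∀ i, p ≠ γ i) (hq : ∀ i, q ≠ γ i) (hr : ∀ i, r ≠ γ i) : False := by
  obtain ⟨x, y, z, i, hxy, hyz, hxz, hxi, hx, hy, hz⟩ : ∃ x y z i, G.Adj x y ∧ G.Adj y z ∧
      x ≠ z ∧ G.Adj x (γ i) ∧ (∀ i, x ≠ γ i) ∧ (∀ i, y ≠ γ i) ∧ (∀ i, z ≠ γ i) := by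
    by_cases hp1 : ∃ i, G.Adj p (γ i)
    · obtain ⟨i, hi⟩ := hp1
      exact ⟨p, q, r, i, hpq, hqr, hpr, hi, hp, hq, hr⟩
    · set K : Set V := {w | (∀ i, w ≠ γ i) ∧ ¬ ∃ i, G.Adj w (γ i)} with hK
      obtain ⟨u, w, huw, huK, hwK⟩ := bdry hconn K p (γ 0) ⟨hp, hp1⟩ (by
        intro hc; exact hc.1 0 rfl)
      have ho : ∀ b, G.Adj u b → ∀ i, b ≠ γ i := by
        rintro b hb i rfl
        exact huK.2 ⟨i, hb⟩
      have hw : ∃ i, G.Adj w (γ i) := by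
        by_contra hc
        exact hwK ⟨ho w huw, hc⟩
      obtain ⟨i, hi⟩ := hw
      obtain ⟨t, ht, htw, -⟩ := third u w w (hh.trans (hδ u))
      exact ⟨w, u, t, i, huw.symm, ht, htw.symm, hi, ho w huw, huK.1, ho t ht⟩
  have hzn : ∀ w, G.Adj z w → (∀ i, w ≠ γ i) → w = x ∨ w = y := fun w hw ho =>
    X.endn hsum x y z w i hxy hyz hxz hxi hx hy hz ho hw
  by_cases hxz' : G.Adj x z
  · have hyn : ∀ w, G.Adj y w → (∀ i, w ≠ γ i) → w = x ∨ w = z := fun w hw ho =>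
      X.endn hsum x z y w i hxz' hyz.symm hxy.ne hxi hx hz hy ho hw
    have hzi := X.tri0 hh hδ x y z i hxy hyz hxz hxi hx hy hz hzn
    have hxn : ∀ w, G.Adj x w → (∀ i, w ≠ γ i) → w = y ∨ w = z := fun w hw ho =>
      (X.endn hsum z y x w i hyz.symm hxy.symm hxz.symm hzi hz hy hx ho hw).symm
    have hrot : ∀ w : V, (∀ k, w ≠ γ (i + k)) → ∀ j, w ≠ γ j := by
      intro w ho j
      have := ho (j + 2 * h * i - i)
      have e : γ (i + (j + 2 * h * i - i)) = γ j := by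
        have : i + (j + 2 * h * i - i) = j + i * (2 * h) := by
          have : i ≤ 2 * h * i := by nlinarith
          have e2 : 2 * h * i = i * (2 * h) := by ring
          omega
        rw [this]
        exact Function.Periodic.nat_mul (f := γ) (c := 2 * h) X.per i j
      simpa [e] using this
    exact (X.rot i).trifin hb hb1 hsum hh hconn hcard hδ x y z hxy hyz hxz hxi (fun _ => hx _)
      (fun _ => hy _) (fun _ => hz _) (fun w hw ho => hxn w hw (hrot w ho))
      (fun w hw ho => hyn w hw (hrot w ho)) (fun w hw ho => hzn w hw (hrot w ho))
  · refine X.star hh hδ x y z i hxy hyz hxz hxi hx hy hz ?_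
    intro w hw ho
    rcases hzn w hw ho with rfl | rfl
    · exact absurd hw.symm hxz'
    · rfl

theorem stmt_16 {V : Type*} [Fintype V] [DecidableEq V] (G : SimpleGraph V)
    [DecidableRel G.Adj] (h b₁ b₂ : ℕ) (hb : b₂ ≤ b₁) (hb1 : 1 ≤ b₂)
    (hsum : b₁ + b₂ = h + 1) (hh : 3 ≤ h)
    (hconn : G.Connected) (hcard : 2 * h + 4 ≤ Fintype.card V)
    (hδ : ∀ v, h ≤ G.degree v)
    (v : V) (c : G.Walk v v) (hc : c.IsCycle)
    (hlong : ∀ (w : V) (d : G.Walk w w), d.IsCycle → d.length ≤ c.length)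
    (hlen : c.length = 2 * h)
    (hF : ¬ ContainsForest G ![2 * b₁ + 1, 2 * b₂ + 1]) :
    ¬ SubgraphOf (SimpleGraph.pathGraph 3) (G.induce {x | x ∉ c.support}) := by
  rintro ⟨f, hf⟩
  have hmodlt : ∀ i, i % (2 * h) < 2 * h := fun i => Nat.mod_lt _ (by omega)
  have hget : ∀ i, c.getVert (i % (2 * h)) ∈ c.support := fun i => c.getVert_mem_support _
  have X : Cx G h b₁ b₂ (fun i => c.getVert (i % (2 * h))) := by
    refine ⟨?_, ?_, ?_, ?_, ?_⟩
    · intro i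
      have h1 := c.adj_getVert_succ (i := i % (2 * h)) (by rw [hlen]; exact hmodlt i)
      by_cases hlt : i % (2 * h) + 1 < 2 * h
      · have : (i + 1) % (2 * h) = i % (2 * h) + 1 := by
          rw [Nat.add_mod, Nat.mod_eq_of_lt (a := 1) (by omega), Nat.mod_eq_of_lt hlt]
        simp only [this]
        exact h1
      · have e : i % (2 * h) + 1 = 2 * h := by have := hmodlt i; omega
        have : (i + 1) % (2 * h) = 0 := by
          rw [Nat.add_mod, Nat.mod_eq_of_lt (a := 1) (by omega), e, Nat.mod_self]
        simp only [this]
        rw [e, ← hlen, Walk.getVert_length, hlen] at h1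
        rwa [Walk.getVert_zero]
    · intro i
      simp
    · intro i j hij hj he
      have := hc.getVert_injOn' (by have := hmodlt i; simp only [Set.mem_ofPred_eq]; omega)
        (by have := hmodlt j; simp only [Set.mem_ofPred_eq]; omega) he
      have h2 : 2 * h ∣ j - i := (Nat.modEq_iff_dvd' hij.le).1 this
      have := Nat.le_of_dvd (by omega) h2
      omega
    · intro a l e hch hnd hl hea
      have hne : a :: l ++ [e] ≠ [] := by simp
      obtain ⟨p, hp⟩ : ∃ p : G.Walk a e, p.support = a :: l ++ [e] := by
        have q1 : (a :: l ++ [e]).head hne = a := by simp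
        have q2 : (a :: l ++ [e]).getLast hne = e := by simp
        refine ⟨(Walk.ofSupport _ hne hch).copy q1 q2, ?_⟩
        rw [Walk.support_copy, Walk.support_ofSupport]
      have hpl : p.length = l.length + 1 := by
        have := p.length_support
        rw [hp] at this
        simp at this
        omega
      have hpp : p.IsPath := by rw [Walk.isPath_def, hp]; exact hnd
      have hcyc : (Walk.cons hea p).IsCycle := by
        rw [Walk.cons_isCycle_iff]
        refine ⟨hpp, ?_⟩
        intro hm
        rw [Sym2.eq_swap] at hm
        have := hpp.length_eq_one_of_mem_edges hm
        omega
      have := hlong _ _ hcyc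
      rw [Walk.length_cons] at this
      omega
    · intro l₁ l₂ h1 h2 hnd e1 e2
      apply hF
      rw [List.nodup_append] at hnd
      obtain ⟨n1, n2, n3⟩ := hnd
      refine ⟨fun i => match i with
        | 0 => fun k => l₁[k.1]'(by have := k.2; simp at this; omega)
        | 1 => fun k => l₂[k.1]'(by have := k.2; simp at this; omega), ?_, ?_, ?_⟩
      · intro i
        fin_cases i
        · intro a b hab
          exact Fin.ext ((n1.getElem_inj_iff).1 hab)
        · intro a b hab
          exact Fin.ext ((n2.getElem_inj_iff).1 hab)
      · intro i j hij a b
        fin_cases i <;> fin_cases j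
        · exact absurd rfl hij
        · exact n3 _ (List.getElem_mem _) _ (List.getElem_mem _)
        · exact (n3 _ (List.getElem_mem _) _ (List.getElem_mem _)).symm
        · exact absurd rfl hij
      · intro i a ha
        rw [List.isChain_iff_getElem] at h1 h2
        fin_cases i
        · exact h1 a (by simp at ha; omega)
        · exact h2 a (by simp at ha; omega)
  have hout : ∀ (w : {x | x ∉ c.support}) (i : ℕ), w.1 ≠ c.getVert (i % (2 * h)) := by
    intro w i he
    exact w.2 (by rw [he]; exact hget i)
  refine X.main hb hb1 hsum hh hconn hcard hδ (f 0) (f 1) (f 2) ?_ ?_ ?_ (hout _) (hout _) (hout _)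
  · exact hf 0 1 (by simp [SimpleGraph.pathGraph_adj])
  · exact hf 1 2 (by simp [SimpleGraph.pathGraph_adj])
  · intro he
    have := f.injective (Subtype.ext he)
    simp at this
end

section
/- Let b₁ ≥ b₂ ≥ 1 with h := b₁ + b₂ - 1 ≥ 3, and let G be a connected graph on n ≥ 2h+4 vertices with minimum degree at least h whose longest cycle has length exactly 2h. Then G contains P_{2b₁+1} ∪ P_{2b₂+1}, unless G ⊆ S_{n,h} = K_h ∨ complement(K_{n-h}), or (b₁,b₂) = (3,1) (so the forest is P_7 ∪ P_3), n is even, and G ⊆ K_2 ∨ ((n-2)/2)K_2. -/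
open SimpleGraph

/-- periodic parametrisation of a cycle of length `2h` -/
def Cyc {V : Type*} (G : SimpleGraph V) (h : ℕ) (c : ℤ → V) : Prop :=
  (∀ i, G.Adj (c i) (c (i + 1))) ∧ ∀ i j, c i = c j ↔ (2 * h : ℤ) ∣ i - j

/-- list path -/
def Pth {V : Type*} (G : SimpleGraph V) (l : List V) : Prop := l.IsChain G.Adj ∧ l.Nodup

/-- no cycle longer than `2h` -/
def NoLong {V : Type*} (G : SimpleGraph V) (h : ℕ) : Prop :=
  ∀ l : List V, Pth G l → 3 ≤ l.length →
    (∀ a ∈ l.getLast?, ∀ b ∈ l.head?, G.Adj a b) → l.length ≤ 2 * h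

/-- segment of the cycle -/
def seg {V : Type*} (c : ℤ → V) (i : ℤ) (m : ℕ) : List V :=
  (List.range m).map fun t : ℕ => c (i + (t : ℤ))

section basic
variable {V : Type*} {G : SimpleGraph V} {h : ℕ} {c : ℤ → V}

theorem seg_length (i : ℤ) (m : ℕ) : (seg c i m).length = m := by simp [seg]

theorem seg_mem {i : ℤ} {m : ℕ} {v : V} (hv : v ∈ seg c i m) :
    ∃ j, i ≤ j ∧ j < i + m ∧ v = c j := by
  simp only [seg, List.mem_map, List.mem_range] at hv
  obtain ⟨t, ht, rfl⟩ := hv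
  exact ⟨i + t, by omega, by omega, rfl⟩

theorem seg_head (i : ℤ) (m : ℕ) (hm : 0 < m) : (seg c i m).head? = some (c i) := by
  simp [seg, List.head?_range, hm.ne']

theorem seg_last (i : ℤ) (m : ℕ) (hm : 0 < m) :
    (seg c i m).getLast? = some (c (i + m - 1)) := by
  simp only [seg, List.getLast?_map, List.getLast?_range, hm.ne', if_false, Option.map_some]
  congr 2; omega

theorem seg_chain (hc : Cyc G h c) (i : ℤ) (m : ℕ) : (seg c i m).IsChain G.Adj := by
  rw [seg, List.isChain_map, List.isChain_range]
  intro t _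
  have := hc.1 (i + t)
  rw [show i + ((Nat.succ t : ℕ) : ℤ) = i + t + 1 by push_cast; ring]
  exact this

theorem Cyc.ne (hc : Cyc G h c) {i j : ℤ} (h1 : i < j) (h2 : j < i + 2 * h) : c i ≠ c j := by
  intro he
  have := (hc.2 j i).1 he.symm
  have := Int.le_of_dvd (by omega) this
  omega

theorem Cyc.per (hc : Cyc G h c) (i : ℤ) : c (i + 2 * h) = c i :=
  (hc.2 _ _).2 (by simp)

theorem seg_nodup (hc : Cyc G h c) (i : ℤ) (m : ℕ) (hm : m ≤ 2 * h) : (seg c i m).Nodup := by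
  rw [seg, List.nodup_map_iff_inj_on List.nodup_range]
  intro a ha b hb hab
  simp only [List.mem_range] at ha hb
  rcases lt_trichotomy a b with hl | hl | hl
  · exact absurd hab (hc.ne (by omega) (by omega))
  · exact hl
  · exact absurd hab.symm (hc.ne (by omega) (by omega))

theorem Cyc.shift (hc : Cyc G h c) (s : ℤ) : Cyc G h (fun i => c (i + s)) := by
  refine ⟨fun i => ?_, fun i j => ?_⟩
  · have := hc.1 (i + s)
    rwa [show i + s + 1 = i + 1 + s by ring] at this
  · rw [hc.2]; simp

theorem Cyc.neg (hc : Cyc G h c) : Cyc G h (fun i => c (-i)) := by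
  refine ⟨fun i => ?_, fun i j => ?_⟩
  · have := hc.1 (-(i + 1))
    rw [show -(i + 1) + 1 = -i by ring] at this
    exact this.symm
  · rw [hc.2, show -i - -j = -(i - j) by ring, dvd_neg]

theorem Cyc.rep (hc : Cyc G h c) (hh : 0 < h) (s i : ℤ) :
    ∃ j, s ≤ j ∧ j < s + 2 * h ∧ c j = c i := by
  refine ⟨s + (i - s) % (2 * h), ?_, ?_, ?_⟩
  · have := Int.emod_nonneg (i - s) (b := 2 * h) (by omega); omega
  · have := Int.emod_lt_of_pos (i - s) (b := 2 * h) (by omega); omega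
  · rw [hc.2]
    have := Int.emod_add_mul_ediv (i - s) (2 * h)
    exact ⟨-((i - s) / (2 * h)), by linarith⟩

theorem Pth.append {l₁ l₂ : List V} (h1 : Pth G l₁) (h2 : Pth G l₂)
    (hd : ∀ a ∈ l₁, ∀ b ∈ l₂, a ≠ b)
    (ha : ∀ x ∈ l₁.getLast?, ∀ y ∈ l₂.head?, G.Adj x y) : Pth G (l₁ ++ l₂) := by
  refine ⟨List.isChain_append.2 ⟨h1.1, h2.1, ha⟩, List.nodup_append.2 ⟨h1.2, h2.2, hd⟩⟩

theorem Pth.reverse {l : List V} (h1 : Pth G l) : Pth G l.reverse := by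
  refine ⟨List.isChain_reverse.2 (h1.1.imp fun _ _ h => h.symm), List.nodup_reverse.2 h1.2⟩

theorem Pth.rot {l₁ l₂ : List V} (h1 : Pth G (l₁ ++ l₂))
    (ha : ∀ x ∈ l₂.getLast?, ∀ y ∈ l₁.head?, G.Adj x y) : Pth G (l₂ ++ l₁) := by
  have h2 := List.isChain_append.1 h1.1
  have h3 := List.nodup_append.1 h1.2
  exact Pth.append ⟨h2.2.1, h3.2.1⟩ ⟨h2.1, h3.1⟩ (fun a ha b hb => (h3.2.2 b hb a ha).symm) ha

theorem Pth.take {l : List V} (h1 : Pth G l) (n : ℕ) : Pth G (l.take n) :=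
  ⟨h1.1.take n, h1.2.take⟩

theorem Pth.drop {l : List V} (h1 : Pth G l) (n : ℕ) : Pth G (l.drop n) :=
  ⟨h1.1.drop n, h1.2.drop⟩

theorem seg_pth (hc : Cyc G h c) (i : ℤ) (m : ℕ) (hm : m ≤ 2 * h) : Pth G (seg c i m) :=
  ⟨seg_chain hc i m, seg_nodup hc i m hm⟩

theorem forest_of_lists {l₁ l₂ : List V} {m₁ m₂ : ℕ} (h1 : Pth G l₁) (h2 : Pth G l₂)
    (hd : ∀ a ∈ l₁, ∀ b ∈ l₂, a ≠ b) (hm₁ : m₁ ≤ l₁.length) (hm₂ : m₂ ≤ l₂.length) :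
    ContainsForest G ![m₁, m₂] := by
  refine ⟨Fin.cons (fun a : Fin m₁ => l₁[a.val]) (Fin.cons (fun a : Fin m₂ => l₂[a.val])
    (fun i => i.elim0)), ?_, ?_, ?_⟩
  · intro i
    fin_cases i
    · intro a b hab
      exact Fin.ext ((List.Nodup.getElem_inj_iff h1.2).1 hab)
    · intro a b hab
      exact Fin.ext ((List.Nodup.getElem_inj_iff h2.2).1 hab)
  · intro i j hij a b
    fin_cases i <;> fin_cases j
    · exact absurd rfl hij
    · exact hd _ (List.getElem_mem _) _ (List.getElem_mem _)
    · exact (hd _ (List.getElem_mem _) _ (List.getElem_mem _)).symm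
    · exact absurd rfl hij
  · intro i a ha
    fin_cases i
    · exact List.isChain_iff_getElem.1 h1.1 a (lt_of_lt_of_le ha hm₁)
    · exact List.isChain_iff_getElem.1 h2.1 a (lt_of_lt_of_le ha hm₂)

theorem forest_of_list {l : List V} {m₁ m₂ : ℕ} (h1 : Pth G l)
    (hm : m₁ + m₂ ≤ l.length) : ContainsForest G ![m₁, m₂] := by
  refine forest_of_lists (h1.take m₁) (h1.drop m₁) ?_ (by simp; omega) (by simp; omega)
  have := h1.2
  rw [← List.take_append_drop m₁ l] at this
  exact (List.nodup_append.1 this).2.2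

theorem noLong_of_walk (N : ℕ)
    (hl : ∀ (w : V) (d : G.Walk w w), d.IsCycle → d.length ≤ 2 * N) : NoLong G N := by
  intro l hp h3 hadj
  have hne : l ≠ [] := by rintro rfl; simp at h3
  have hA : G.Adj (l.getLast hne) (l.head hne) :=
    hadj _ (List.getLast_mem_getLast? hne) _ (List.head_mem_head? hne)
  have hsup := Walk.support_ofSupport (G := G) hne hp.1
  set w := Walk.ofSupport l hne hp.1 with hw
  have hpath : w.IsPath := Walk.IsPath.mk' (by rw [hsup]; exact hp.2)
  have hlen : w.length + 1 = l.length := by rw [← Walk.length_support, hsup]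
  have hcy : (Walk.cons hA w).IsCycle := by
    rw [Walk.cons_isCycle_iff]
    refine ⟨hpath, fun he => ?_⟩
    have := hpath.length_eq_one_of_mem_edges (by rwa [Sym2.eq_swap])
    omega
  have := hl _ _ hcy
  simp only [Walk.length_cons] at this
  omega

theorem cyc_of_walk {v : V} (w : G.Walk v v) (hw : w.IsCycle) (hlen : w.length = 2 * h) 
    (hh : 0 < h) : Cyc G h (fun i => w.getVert (i % (2 * h : ℤ)).toNat) := by
  have hb : ∀ i : ℤ, 0 ≤ i % (2 * h : ℤ) ∧ i % (2 * h : ℤ) < 2 * h := fun i =>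
    ⟨Int.emod_nonneg _ (by omega), Int.emod_lt_of_pos _ (by omega)⟩
  refine ⟨fun i => ?_, fun i j => ?_⟩
  · have h1 := hb i
    have h2 := hb (i + 1)
    have h3 := w.adj_getVert_succ (i := (i % (2 * h : ℤ)).toNat) (by omega)
    by_cases he : i % (2 * h : ℤ) = 2 * h - 1
    · have h4 : (i + 1) % (2 * h : ℤ) = 0 := by
        rw [← Int.emod_add_emod, he]; simp
      have h5 : (i % (2 * h : ℤ)).toNat + 1 = w.length := by omega
      rw [h5, w.getVert_length] at h3
      simpa [h4] using h3
    · have h4 : (i + 1) % (2 * h : ℤ) = i % (2 * h) + 1 := by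
        rw [← Int.emod_add_emod]
        exact Int.emod_eq_of_lt (by omega) (by omega)
      have h5 : ((i + 1) % (2 * h : ℤ)).toNat = (i % (2 * h : ℤ)).toNat + 1 := by omega
      simp only [h5]
      exact h3
  · have h1 := hb i
    have h2 := hb j
    constructor
    · intro he
      have := hw.getVert_injOn' (by simp; omega) (by simp; omega) he
      apply Int.dvd_of_emod_eq_zero
      apply Int.emod_eq_emod_iff_emod_sub_eq_zero.1
      omega
    · intro he
      have : i % (2 * h : ℤ) = j % (2 * h) := by
        apply Int.emod_eq_emod_iff_emod_sub_eq_zero.2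
        exact Int.emod_eq_zero_of_dvd he
      simp [this]

end basic

/-- path avoiding the cycle -/
def RPth {V : Type*} (G : SimpleGraph V) (c : ℤ → V) (l : List V) : Prop :=
  Pth G l ∧ ∀ v ∈ l, ∀ i, v ≠ c i

theorem packing (S : Finset ℤ) (L U d : ℤ) (hd : 0 < d) (hS : ∀ x ∈ S, L ≤ x ∧ x ≤ U)
    (hsep : ∀ x ∈ S, ∀ y ∈ S, x < y → d ≤ y - x) (hne : S.Nonempty) :
    d * ((S.card : ℤ) - 1) ≤ U - L := by
  have hLU : L ≤ U := by obtain ⟨x, hx⟩ := hne; have := hS x hx; omega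
  have hq : 0 ≤ (U - L) / d := Int.ediv_nonneg (by omega) hd.le
  have hle : S.card ≤ (Finset.Icc (0 : ℤ) ((U - L) / d)).card := by
    apply Finset.card_le_card_of_injOn (fun x => (x - L) / d)
    · intro x hx
      have := hS x hx
      simp only [Finset.coe_Icc, Set.mem_Icc]
      exact ⟨Int.ediv_nonneg (by omega) hd.le, Int.ediv_le_ediv hd (by omega)⟩
    · have key : ∀ x ∈ S, ∀ y ∈ S, x < y → (x - L) / d ≠ (y - L) / d := by
        intro x hx y hy hxy he
        have h1 := hsep x hx y hy hxy
        have h2 := Int.mul_ediv_add_emod (x - L) d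
        have h3 := Int.mul_ediv_add_emod (y - L) d
        have h4 := Int.emod_lt_of_pos (y - L) hd
        have h5 := Int.emod_nonneg (x - L) hd.ne'
        rw [he] at h2
        omega
      intro x hx y hy he
      rcases lt_trichotomy x y with hl | hl | hl
      · exact absurd he (key x hx y hy hl)
      · exact hl
      · exact absurd he.symm (key y hy x hx hl)
  rw [Int.card_Icc] at hle
  have h1 : (S.card : ℤ) - 1 ≤ (U - L) / d := by omega
  calc d * ((S.card : ℤ) - 1) ≤ d * ((U - L) / d) := by
        exact mul_le_mul_of_nonneg_left h1 hd.le
    _ ≤ U - L := Int.mul_ediv_self_le hd.ne'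

theorem AB_sub (A B : ℤ → Prop) [DecidablePred A] (h k : ℕ) (hk2 : 2 ≤ k) (hkh : k ≤ h)
    (hpB : ∀ i j, (2 * h : ℤ) ∣ i - j → B i → B j)
    (hAA : ∀ i j, A i → A j → i < j → j < i + 2 * h → 2 ≤ j - i)
    (hAB : ∀ i j, A i → B j → i < j → j < i + 2 * h → (k : ℤ) + 1 ≤ j - i)
    (hBA : ∀ i j, B i → A j → i < j → j < i + 2 * h → (k : ℤ) + 1 ≤ j - i)
    (hcA : ∀ s : ℤ, h + 1 ≤ k + ((Finset.Ico s (s + 2 * h)).filter A).card)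
    (b : ℤ) (hb : B b) : A b := by
  by_contra hn
  set S := (Finset.Ico b (b + 2 * h)).filter A with hS
  have hm : ∀ x ∈ S, b < x ∧ x < b + 2 * h ∧ A x := by
    intro x hx
    simp only [hS, Finset.mem_filter, Finset.mem_Ico] at hx
    refine ⟨lt_of_le_of_ne hx.1.1 ?_, hx.1.2, hx.2⟩
    rintro rfl; exact hn hx.2
  have hc := hcA b
  rw [← hS] at hc
  have hb' : B (b + 2 * h) := hpB b _ ⟨-1, by ring⟩ hb
  have := packing S (b + k + 1) (b + 2 * h - k - 1) 2 (by norm_num) (fun x hx => by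
    have h1 := hm x hx
    have h2 := hBA b x hb h1.2.2 h1.1 h1.2.1
    have h3 := hAB x _ h1.2.2 hb' h1.2.1 (by omega)
    omega) (fun x hx y hy hxy => by
    have h1 := hm x hx
    have h2 := hm y hy
    exact hAA x y h1.2.2 h2.2.2 hxy (by omega)) (Finset.card_pos.1 (by omega))
  omega

theorem AB_main (A B : ℤ → Prop) [DecidablePred A] [DecidablePred B] (h k : ℕ) (hk2 : 2 ≤ k)
    (hkh : k ≤ h)
    (hpA : ∀ i j, (2 * h : ℤ) ∣ i - j → A i → A j)
    (hpB : ∀ i j, (2 * h : ℤ) ∣ i - j → B i → B j)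
    (hAA : ∀ i j, A i → A j → i < j → j < i + 2 * h → 2 ≤ j - i)
    (hBB : ∀ i j, B i → B j → i < j → j < i + 2 * h → 2 ≤ j - i)
    (hAB : ∀ i j, A i → B j → i < j → j < i + 2 * h → (k : ℤ) + 1 ≤ j - i)
    (hBA : ∀ i j, B i → A j → i < j → j < i + 2 * h → (k : ℤ) + 1 ≤ j - i)
    (hcA : ∀ s : ℤ, h + 1 ≤ k + ((Finset.Ico s (s + 2 * h)).filter A).card)
    (hcB : ∀ s : ℤ, h + 1 ≤ k + ((Finset.Ico s (s + 2 * h)).filter B).card) :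
    (∀ i, A i ↔ B i) ∧ ((k = h ∧ ∃ s, ∀ i, A i ↔ (2 * h : ℤ) ∣ i - s) ∨
      (k + 1 = h ∧ ∃ s, ∀ i, A i ↔ (h : ℤ) ∣ i - s)) := by
  have hiff : ∀ i, A i ↔ B i := fun i =>
    ⟨AB_sub B A h k hk2 hkh hpA hBB hBA hAB hcB i, AB_sub A B h k hk2 hkh hpB hAA hAB hBA hcA i⟩
  refine ⟨hiff, ?_⟩
  have hAA' : ∀ i j, A i → A j → i < j → j < i + 2 * h → (k : ℤ) + 1 ≤ j - i :=
    fun i j hi hj => hAB i j hi ((hiff j).1 hj)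
  obtain ⟨b, hb⟩ : ∃ b, A b := by
    have := hcA 0
    obtain ⟨b, hb⟩ := Finset.card_pos.1 (show 0 < ((Finset.Ico (0:ℤ) (0 + 2 * h)).filter A).card by omega)
    exact ⟨b, (Finset.mem_filter.1 hb).2⟩
  have hrep : ∀ i, ∃ j, b ≤ j ∧ j < b + 2 * h ∧ (2 * h : ℤ) ∣ i - j := by
    intro i
    refine ⟨b + (i - b) % (2 * h), ?_, ?_, ?_⟩
    · have := Int.emod_nonneg (i - b) (b := 2 * h) (by omega); omega
    · have := Int.emod_lt_of_pos (i - b) (b := 2 * h) (by omega); omega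
    · have := Int.emod_add_mul_ediv (i - b) (2 * h)
      exact ⟨((i - b) / (2 * h)), by linarith⟩
  set S := (Finset.Ico b (b + 2 * h)).filter A with hS
  have hbS : b ∈ S := by simp [hS, hb]; omega
  have hm : ∀ x ∈ S.erase b, b < x ∧ x < b + 2 * h ∧ A x := by
    intro x hx
    simp only [hS, Finset.mem_erase, Finset.mem_filter, Finset.mem_Ico] at hx
    exact ⟨lt_of_le_of_ne hx.2.1.1 (Ne.symm hx.1), hx.2.1.2, hx.2.2⟩
  have hcard := Finset.card_erase_add_one hbS
  have hc := hcA b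
  rw [← hS] at hc
  have hb' : A (b + 2 * h) := hpA b _ ⟨-1, by ring⟩ hb
  have hbd : ∀ x ∈ S.erase b, b + k + 1 ≤ x ∧ x ≤ b + 2 * h - k - 1 := fun x hx => by
    have h1 := hm x hx
    have h2 := hAA' b x hb h1.2.2 h1.1 h1.2.1
    have h3 := hAA' x _ h1.2.2 hb' h1.2.1 (by omega)
    omega
  rcases (S.erase b).eq_empty_or_nonempty with he | hne
  · left
    rw [he] at hcard
    simp only [Finset.card_empty] at hcard
    refine ⟨by omega, b, fun i => ⟨fun hi => ?_, fun hi => ?_⟩⟩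
    · obtain ⟨j, h1, h2, h3⟩ := hrep i
      have hj : A j := hpA _ _ h3 hi
      have : j = b := by
        by_contra hjb
        have : j ∈ S.erase b := by simp [hS, hjb, h1, h2, hj]
        rw [he] at this; simp at this
      rwa [this] at h3
    · exact hpA b i ((dvd_sub_comm).1 hi) hb
  · right
    have hlt : (k : ℤ) + 1 ≤ h := by
      obtain ⟨x, hx⟩ := hne; have := hbd x hx; omega
    have hp := packing (S.erase b) (b + k + 1) (b + 2 * h - k - 1) (k + 1) (by omega) hbd
      (fun x hx y hy hxy => by
        have h1 := hm x hx
        have h2 := hm y hy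
        exact hAA' x y h1.2.2 h2.2.2 hxy (by omega)) hne
    have hcc : (h : ℤ) - k - 1 ≤ ((S.erase b).card : ℤ) - 1 := by omega
    have hk : k + 1 = h := by
      by_contra hk
      have h5 : (1 : ℤ) ≤ h - k - 1 := by omega
      nlinarith
    refine ⟨hk, b, fun i => ⟨fun hi => ?_, fun hi => ?_⟩⟩
    · obtain ⟨j, h1, h2, h3⟩ := hrep i
      have hj : A j := hpA _ _ h3 hi
      have h4 : (h : ℤ) ∣ i - j := dvd_trans ⟨2, by ring⟩ h3
      by_cases hjb : j = b
      · rwa [hjb] at h4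
      · have h5 := hbd j (by simp [hS, hjb, h1, h2, hj])
        have h6 : j = b + h := by omega
        rw [h6] at h4
        have := dvd_add h4 (dvd_refl (h : ℤ))
        rwa [show i - (b + h) + (h : ℤ) = i - b by ring] at this
    · obtain ⟨j, h1, h2, h3⟩ := hrep i
      have h4 : (h : ℤ) ∣ i - j := dvd_trans ⟨2, by ring⟩ h3
      have h5 : (h : ℤ) ∣ j - b := by
        have := dvd_sub hi h4
        rwa [show i - b - (i - j) = j - b by ring] at this
      apply hpA j i ((dvd_sub_comm).1 h3)
      obtain ⟨t, ht⟩ := h5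
      obtain ⟨x, hx⟩ := hne
      have hx1 := hbd x hx
      have hx2 := (hm x hx).2.2
      have hx3 : x = b + h := by omega
      have ht0 : 0 ≤ t := by
        by_contra hneg
        have : t ≤ -1 := by omega
        nlinarith
      have ht1 : t < 2 := by
        by_contra hneg
        have : 2 ≤ t := by omega
        nlinarith
      interval_cases t
      · have : j = b := by omega
        rwa [this]
      · have : j = b + h := by omega
        rwa [this, ← hx3]

theorem alt_main (A : ℤ → Prop) [DecidablePred A] (h : ℕ) (hh : 2 ≤ h)
    (hpA : ∀ i j, (2 * h : ℤ) ∣ i - j → A i → A j)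
    (hAA : ∀ i j, A i → A j → i < j → j < i + 2 * h → 2 ≤ j - i)
    (hcA : ∀ s : ℤ, h ≤ ((Finset.Ico s (s + 2 * h)).filter A).card) (i : ℤ) (hi : A i) :
    A (i + 2) := by
  by_contra hn
  set S := (Finset.Ico i (i + 2 * h)).filter A with hS
  have hiS : i ∈ S := by simp [hS, hi]; omega
  have hcard := Finset.card_erase_add_one hiS
  have hc := hcA i
  rw [← hS] at hc
  have hi' : A (i + 2 * h) := hpA i _ ⟨-1, by ring⟩ hi
  have hm : ∀ x ∈ S.erase i, i < x ∧ x < i + 2 * h ∧ A x := by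
    intro x hx
    simp only [hS, Finset.mem_erase, Finset.mem_filter, Finset.mem_Ico] at hx
    exact ⟨lt_of_le_of_ne hx.2.1.1 (Ne.symm hx.1), hx.2.1.2, hx.2.2⟩
  have := packing (S.erase i) (i + 3) (i + 2 * h - 2) 2 (by norm_num) (fun x hx => by
    have h1 := hm x hx
    have h2 := hAA i x hi h1.2.2 h1.1 h1.2.1
    have h3 := hAA x _ h1.2.2 hi' h1.2.1 (by omega)
    have h4 : x ≠ i + 2 := by rintro rfl; exact hn h1.2.2
    omega) (fun x hx y hy hxy => by
    have h1 := hm x hx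
    have h2 := hm y hy
    exact hAA x y h1.2.2 h2.2.2 hxy (by omega)) (Finset.card_pos.1 (by omega))
  omega

section two
variable {V : Type*} {G : SimpleGraph V} {h : ℕ} {c : ℤ → V}

theorem gap (hc : Cyc G h c) (hN : NoLong G h) {p : List V} (hp : RPth G c p) {a b : V}
    (ha : p.head? = some a) (hb : p.getLast? = some b) {i j : ℤ} (hai : G.Adj a (c i))
    (hbj : G.Adj b (c j)) (hij : i < j) (hji : j < i + 2 * h) : (p.length : ℤ) + 1 ≤ j - i := by
  obtain ⟨m, hm⟩ : ∃ m : ℕ, (m : ℤ) = i + 2 * h - j + 1 := ⟨(i + 2 * h - j + 1).toNat, by omega⟩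
  have hpos : 0 < p.length := by
    cases p with
    | nil => simp at ha
    | cons => simp
  have hne : p ≠ [] := by rintro rfl; simp at hpos
  have hsn : seg c j m ≠ [] := by
    intro hs
    have := seg_length (c := c) j m
    rw [hs] at this; simp at this; omega
  have h1 : Pth G (p ++ seg c j m) := by
    refine hp.1.append (seg_pth hc _ _ (by omega)) ?_ ?_
    · intro x hx y hy
      obtain ⟨t, -, -, rfl⟩ := seg_mem hy
      exact hp.2 x hx t
    · rw [hb, seg_head _ _ (by omega)]
      intro x hx y hy
      simp at hx hy; subst hx; subst hy; exact hbj
  have h2 := hN _ h1 (by simp only [List.length_append, seg_length]; omega) (by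
    rw [List.getLast?_append_of_ne_nil _ hsn, List.head?_append_of_ne_nil _ hne, ha,
      seg_last _ _ (by omega)]
    intro x hx y hy
    simp at hx hy; subst hx; subst hy
    rw [hm, show j + (i + 2 * h - j + 1) - 1 = i + 2 * h by ring, hc.per]
    exact hai.symm)
  simp only [List.length_append, seg_length] at h2
  omega

theorem gap1 (hc : Cyc G h c) (hN : NoLong G h) {a : V} (hao : ∀ i, a ≠ c i) {i j : ℤ}
    (hai : G.Adj a (c i)) (haj : G.Adj a (c j)) (hij : i < j) (hji : j < i + 2 * h) :
    2 ≤ j - i := by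
  have := gap hc hN (p := [a]) ⟨⟨by simp, by simp⟩, by simpa using hao⟩ (a := a) (b := a) rfl rfl
    hai haj hij hji
  simpa using this

theorem deg_count [Fintype V] [DecidableEq V] [DecidableRel G.Adj] (hc : Cyc G h c) (hh : 0 < h)
    (u : V) (hd : h ≤ G.degree u) (T : Finset V)
    (hT : ∀ z, G.Adj u z → (∀ i, z ≠ c i) → z ∈ T) (s : ℤ) :
    h ≤ T.card + ((Finset.Ico s (s + 2 * h)).filter (fun i => G.Adj u (c i))).card := by
  have hsub : G.neighborFinset u ⊆
      T ∪ ((Finset.Ico s (s + 2 * h)).filter (fun i => G.Adj u (c i))).image c := by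
    intro z hz
    rw [mem_neighborFinset] at hz
    rw [Finset.mem_union]
    by_cases hzc : ∀ i, z ≠ c i
    · exact Or.inl (hT z hz hzc)
    · push Not at hzc
      obtain ⟨i, rfl⟩ := hzc
      right
      obtain ⟨j, h1, h2, h3⟩ := hc.rep hh s i
      rw [Finset.mem_image]
      exact ⟨j, by simp [h1, h2, h3, hz], h3⟩
  have h1 := Finset.card_le_card hsub
  rw [card_neighborFinset_eq_degree] at h1
  have h2 := Finset.card_union_le T
    (((Finset.Ico s (s + 2 * h)).filter (fun i => G.Adj u (c i))).image c)
  have h3 := Finset.card_image_le (s := (Finset.Ico s (s + 2 * h)).filter (fun i => G.Adj u (c i)))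
    (f := c)
  omega

theorem max_head {p : List V} (hp : RPth G c p) (hmax : ∀ q, RPth G c q → q.length ≤ p.length)
    {a : V} (ha : p.head? = some a) {z : V} (haz : G.Adj a z) (hz : ∀ i, z ≠ c i) : z ∈ p := by
  by_contra hn
  have := hmax (z :: p) ⟨⟨by
    cases p with
    | nil => simp
    | cons x t =>
      simp at ha; subst ha
      exact List.isChain_cons_cons.2 ⟨haz.symm, hp.1.1⟩, List.nodup_cons.2 ⟨hn, hp.1.2⟩⟩, by
    intro v hv
    rcases List.mem_cons.1 hv with rfl | hv
    · exact hz
    · exact hp.2 v hv⟩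
  simp at this

theorem RPth.reverse {p : List V} (hp : RPth G c p) : RPth G c p.reverse :=
  ⟨hp.1.reverse, fun v hv => hp.2 v (List.mem_reverse.1 hv)⟩

theorem deg_head [Fintype V] [DecidableEq V] [DecidableRel G.Adj] (hc : Cyc G h c) (hh : 0 < h)
    (hδ : ∀ v, h ≤ G.degree v)
    {p : List V} (hp : RPth G c p) (hmax : ∀ q, RPth G c q → q.length ≤ p.length)
    {a : V} (ha : p.head? = some a) (s : ℤ) :
    h + 1 ≤ p.length + ((Finset.Ico s (s + 2 * h)).filter (fun i => G.Adj a (c i))).card := by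
  have ham : a ∈ p := List.mem_of_head? ha
  have := deg_count hc hh a (hδ a) (p.toFinset.erase a) (fun z hz hzc => by
    simp only [Finset.mem_erase, List.mem_toFinset]
    exact ⟨hz.ne', max_head hp hmax ha hz hzc⟩) s
  have h2 := Finset.card_erase_add_one (List.mem_toFinset.2 ham)
  rw [List.toFinset_card_of_nodup hp.1.2] at h2
  omega

theorem dichotomy [Fintype V] [DecidableEq V] [DecidableRel G.Adj] (hc : Cyc G h c)
    (hN : NoLong G h) (hh : 3 ≤ h)
    (hδ : ∀ v, h ≤ G.degree v)
    {p : List V} (hp : RPth G c p) (hmax : ∀ q, RPth G c q → q.length ≤ p.length)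
    (h2 : 2 ≤ p.length) (hkh : p.length ≤ h)
    {a b : V} (ha : p.head? = some a) (hb : p.getLast? = some b) :
    (∀ i, G.Adj a (c i) ↔ G.Adj b (c i)) ∧
      ((p.length = h ∧ ∃ s, ∀ i, G.Adj a (c i) ↔ (2 * h : ℤ) ∣ i - s) ∨
      (p.length + 1 = h ∧ ∃ s, ∀ i, G.Adj a (c i) ↔ (h : ℤ) ∣ i - s)) := by
  have hper : ∀ u : V, ∀ i j, (2 * h : ℤ) ∣ i - j → G.Adj u (c i) → G.Adj u (c j) := by
    intro u i j hd hu
    rwa [← (hc.2 i j).2 hd]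
  have har : p.reverse.getLast? = some a := by simpa using ha
  have hbr : p.reverse.head? = some b := by simpa using hb
  have hmaxr : ∀ q, RPth G c q → q.length ≤ p.reverse.length := by simpa using hmax
  refine AB_main (fun i => G.Adj a (c i)) (fun i => G.Adj b (c i)) h p.length h2 hkh (hper a)
    (hper b) ?_ ?_ ?_ ?_ ?_ ?_
  · intro i j hi hj
    exact gap1 hc hN (hp.2 a (List.mem_of_head? ha)) hi hj
  · intro i j hi hj
    exact gap1 hc hN (hp.2 b (List.mem_of_getLast? hb)) hi hj
  · intro i j hi hj
    exact gap hc hN hp ha hb hi hj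
  · intro i j hi hj h1 h2
    have := gap hc hN hp.reverse hbr har hi hj h1 h2
    simpa using this
  · exact deg_head hc (by omega) hδ hp hmax ha
  · intro s
    have := deg_head hc (by omega) hδ hp.reverse hmaxr hbr s
    simpa using this

theorem exists_longest [Fintype V] (c : ℤ → V) (q : List V) (hq : RPth G c q) :
    ∃ p, RPth G c p ∧ q.length ≤ p.length ∧ ∀ r, RPth G c r → r.length ≤ p.length := by
  classical
  let P : ℕ → Prop := fun m => ∃ p, RPth G c p ∧ p.length = m
  have hbd : ∀ r, RPth G c r → r.length ≤ Fintype.card V := fun r hr => hr.1.2.length_le_card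
  have hP : P (Nat.findGreatest P (Fintype.card V)) :=
    Nat.findGreatest_spec (hbd q hq) ⟨q, hq, rfl⟩
  obtain ⟨p, hp, hl⟩ := hP
  have : ∀ r, RPth G c r → r.length ≤ p.length := fun r hr => by
    rw [hl]; exact Nat.le_findGreatest (hbd r hr) ⟨r, hr, rfl⟩
  exact ⟨p, hp, this q hq, this⟩

theorem exists_cross (hconn : G.Connected) (S : Set V) {x y : V} (hx : x ∈ S) (hy : y ∉ S) :
    ∃ u v, u ∈ S ∧ v ∉ S ∧ G.Adj u v := by
  obtain ⟨w⟩ := hconn.preconnected x y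
  obtain ⟨d, -, h1, h2⟩ := w.exists_boundary_dart S hx hy
  exact ⟨d.fst, d.snd, h1, h2, d.adj⟩

end two

section three
variable {V : Type*} {G : SimpleGraph V} {h : ℕ} {c : ℤ → V}

theorem sub_S [Fintype V] [DecidableEq V] (E : Finset V) (hE : E.card = h)
    (hcov : ∀ a b, G.Adj a b → a ∈ E ∨ b ∈ E) :
    SubgraphOf G (Sgraph (Fintype.card V) h) := by
  have hle : h ≤ Fintype.card V := hE ▸ Finset.card_le_univ E
  have hc1 : Fintype.card {v // v ∈ E} = Fintype.card {i : Fin (Fintype.card V) // i.val < h} := by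
    rw [Fintype.card_coe, hE, Fintype.card_subtype]
    have : (Finset.univ.filter fun i : Fin (Fintype.card V) => i.val < h) =
        (Finset.univ : Finset (Fin h)).map (Fin.castLEEmb hle) := by
      ext i
      simp only [Finset.mem_filter, Finset.mem_univ, true_and, Finset.mem_map]
      exact ⟨fun hi => ⟨⟨i, hi⟩, rfl⟩, by rintro ⟨j, rfl⟩; exact j.2⟩
    rw [this]; simp
  have hc2 : Fintype.card {v // ¬ v ∈ E} =
      Fintype.card {i : Fin (Fintype.card V) // ¬ i.val < h} := by
    rw [Fintype.card_subtype_compl, Fintype.card_subtype_compl, hc1, Fintype.card_fin]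
  let e1 := Fintype.equivOfCardEq hc1
  let e2 := Fintype.equivOfCardEq hc2
  let e : V ≃ Fin (Fintype.card V) :=
    (Equiv.sumCompl (· ∈ E)).symm.trans ((Equiv.sumCongr e1 e2).trans
      (Equiv.sumCompl (fun i : Fin (Fintype.card V) => i.val < h)))
  have he : ∀ v ∈ E, (e v).val < h := by
    intro v hv
    have : e v = e1 ⟨v, hv⟩ := by simp [e, hv]
    rw [this]; exact (e1 ⟨v, hv⟩).2
  refine ⟨e.toEmbedding, fun a b hab => ?_⟩
  rw [Sgraph, SimpleGraph.fromRel_adj]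
  refine ⟨fun hh => hab.ne (e.injective hh), ?_⟩
  rcases hcov a b hab with ha | hb
  · exact Or.inl (he a ha)
  · exact Or.inr (he b hb)

theorem iso_alt [Fintype V] [DecidableEq V] [DecidableRel G.Adj] (hc : Cyc G h c)
    (hN : NoLong G h) (hh : 3 ≤ h)
    (hδ : ∀ v, h ≤ G.degree v) {x : V} (hx : ∀ i, x ≠ c i)
    (hiso : ∀ z, G.Adj x z → ∃ i, z = c i) :
    (∃ i, G.Adj x (c i)) ∧ ∀ i, G.Adj x (c i) → G.Adj x (c (i + 2)) := by
  have hcnt : ∀ s : ℤ, h ≤ ((Finset.Ico s (s + 2 * h)).filter (fun i => G.Adj x (c i))).card := by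
    intro s
    have := deg_count hc (by omega) x (hδ x) ∅ (fun z hz hzc => by
      obtain ⟨i, hi⟩ := hiso z hz
      exact absurd hi (hzc i)) s
    simpa using this
  refine ⟨?_, ?_⟩
  · obtain ⟨i, hi⟩ := Finset.card_pos.1 (lt_of_lt_of_le (show 0 < h by omega) (hcnt 0))
    exact ⟨i, (Finset.mem_filter.1 hi).2⟩
  · apply alt_main (fun i => G.Adj x (c i)) h (by omega)
    · intro i j hd hu
      rwa [← (hc.2 i j).2 hd]
    · intro i j hi hj
      exact gap1 hc hN hx hi hj
    · exact hcnt

theorem step_two {A : ℤ → Prop} (h : ℕ) (hh : 0 < h)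
    (hper : ∀ i j, (2 * h : ℤ) ∣ i - j → A i → A j) (h2 : ∀ i, A i → A (i + 2)) (i j : ℤ)
    (hi : A i) (hij : 2 ∣ j - i) : A j := by
  have hn : ∀ n : ℕ, A (i + 2 * n) := by
    intro n
    induction n with
    | zero => simpa using hi
    | succ n ih =>
      have := h2 _ ih
      rwa [show i + 2 * (n : ℤ) + 2 = i + 2 * ((n + 1 : ℕ) : ℤ) by push_cast; ring] at this
  obtain ⟨t, ht⟩ := hij
  have h1 := hn (t + h * |t|).toNat
  have h3 : 0 ≤ t + h * |t| := by
    have := neg_abs_le t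
    have := abs_nonneg t
    nlinarith
  apply hper _ _ _ h1
  rw [Int.toNat_of_nonneg h3]
  exact ⟨|t|, by linear_combination -ht⟩

theorem caseA [Fintype V] [DecidableEq V] [DecidableRel G.Adj] (hc : Cyc G h c)
    (hN : NoLong G h) (hh : 3 ≤ h)
    (hδ : ∀ v, h ≤ G.degree v) {x : V} (hx : ∀ i, x ≠ c i) 
    (hind : ∀ u v, (∀ i, u ≠ c i) → (∀ i, v ≠ c i) → ¬ G.Adj u v) :
    SubgraphOf G (Sgraph (Fintype.card V) h) := by
  have hiso : ∀ u, (∀ i, u ≠ c i) → ∀ z, G.Adj u z → ∃ i, z = c i := by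
    intro u hu z hz
    by_contra hcon
    push Not at hcon
    exact hind u z hu hcon hz
  have hper : ∀ u : V, ∀ i j, (2 * h : ℤ) ∣ i - j → G.Adj u (c i) → G.Adj u (c j) := by
    intro u i j hd hu
    rwa [← (hc.2 i j).2 hd]
  -- shift
  obtain ⟨s, hs⟩ := (iso_alt hc hN hh hδ hx (hiso x hx)).1
  obtain ⟨c', hc', hx', hind', hiso', hper', hs'⟩ : ∃ c' : ℤ → V, Cyc G h c' ∧ (∀ i, x ≠ c' i) ∧
      (∀ u v, (∀ i, u ≠ c' i) → (∀ i, v ≠ c' i) → ¬ G.Adj u v) ∧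
      (∀ u, (∀ i, u ≠ c' i) → ∀ z, G.Adj u z → ∃ i, z = c' i) ∧
      (∀ u : V, ∀ i j, (2 * h : ℤ) ∣ i - j → G.Adj u (c' i) → G.Adj u (c' j)) ∧
      G.Adj x (c' 0) := by
    have hr : ∀ u, (∀ i, u ≠ c (i + s)) → ∀ i, u ≠ c i := fun u hu i => by
      simpa using hu (i - s)
    refine ⟨fun i => c (i + s), hc.shift s, fun i => hx _, ?_, ?_, ?_, by simpa using hs⟩
    · intro u v hu hv
      exact hind u v (hr u hu) (hr v hv)
    · intro u hu z hz
      obtain ⟨i, hi⟩ := hiso u (hr u hu) z hz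
      exact ⟨i - s, by simpa using hi⟩
    · intro u i j hd
      exact hper u _ _ (by simpa using hd)
  clear hc hper hs hiso hind hx
  have hodd : ∀ i : ℤ, 2 ∣ i - 1 → ¬ G.Adj x (c' i) := by
    intro i hi hxi
    have h0 := step_two h (by omega) (hper' x) (iso_alt hc' hN hh hδ hx' (hiso' x hx')).2 i 1 hxi
      ((dvd_sub_comm).1 hi)
    have := gap1 hc' hN hx' hs' h0 (by omega) (by omega)
    omega
  have heven : ∀ i : ℤ, 2 ∣ i → G.Adj x (c' i) := fun i hi =>
    step_two h (by omega) (hper' x) (iso_alt hc' hN hh hδ hx' (hiso' x hx')).2 0 i hs' (by simpa)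
  -- every outside vertex only sees even
  have hR : ∀ y, (∀ i, y ≠ c' i) → ∀ i, G.Adj y (c' i) → 2 ∣ i := by
    intro y hy i hyi
    by_contra hi
    have hst := fun j => step_two h (by omega) (hper' y) (iso_alt hc' hN hh hδ hy (hiso' y hy)).2 i j hyi
    have hy1 := hst 1 (by omega)
    have hy3 := hst 3 (by omega)
    have hxy : x ≠ y := by
      rintro rfl
      exact hodd 1 (by norm_num) hy1
    have hx2 := heven 2 (by norm_num)
    have hl : Pth G ([x, c' 2, c' 1, y] ++ seg c' 3 (2 * h - 2)) := by
      refine Pth.append ⟨?_, ?_⟩ (seg_pth hc' _ _ (by omega)) ?_ ?_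
      · have := (hc'.1 1).symm
        norm_num at this
        simp [hx2, hy1.symm, this]
      · have := (hc'.ne (i := 1) (j := 2) (by omega) (by omega)).symm
        simp [hx', hxy, this, (hy _).symm]
      · intro a ha b hb
        obtain ⟨j, h1, h2, rfl⟩ := seg_mem hb
        simp only [List.mem_cons, List.not_mem_nil, or_false] at ha
        rcases ha with rfl | rfl | rfl | rfl
        · exact hx' j
        · exact hc'.ne (by omega) (by omega)
        · exact hc'.ne (by omega) (by omega)
        · exact hy j
      · rw [seg_head _ _ (by omega)]
        simp [hy3]
    have := hN _ hl (by simp) (by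
      rw [List.getLast?_append_of_ne_nil _ (by
          intro hs; have := seg_length (c := c') 3 (2 * h - 2); rw [hs] at this; simp at this; omega),
        seg_last _ _ (by omega)]
      have h5 : (3 : ℤ) + ((2 * h - 2 : ℕ) : ℤ) - 1 = 0 + 2 * h := by omega
      rw [h5, hc'.per]
      simp [hs'.symm])
    simp [seg_length] at this
    omega
  have hCC : ∀ a b : ℤ, a < b → b < a + 2 * h → 2 ∣ a - 1 → 2 ∣ b - 1 → ¬ G.Adj (c' a) (c' b) := by
    intro a b hab hba ha1 hb1 hadj
    obtain ⟨m, hm⟩ : ∃ m : ℕ, (m : ℤ) = b - a := ⟨(b - a).toNat, by omega⟩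
    have hl : Pth G (seg (fun i => c' (-i)) (-b) m ++ ([x] ++ seg c' (b + 1) (2 * h - m))) := by
      refine Pth.append (seg_pth hc'.neg _ _ (by omega)) (Pth.append ⟨by simp, by simp⟩
        (seg_pth hc' _ _ (by omega)) ?_ ?_) ?_ ?_
      · intro u hu v hv
        simp at hu; subst hu
        obtain ⟨j, h1, h2, rfl⟩ := seg_mem hv
        exact hx' j
      · rw [seg_head _ _ (by omega)]
        simpa using heven (b + 1) (by omega)
      · intro u hu v hv
        obtain ⟨j, h1, h2, rfl⟩ := seg_mem hu
        rcases List.mem_append.1 hv with hv | hv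
        · simp at hv; subst hv; exact (hx' _).symm
        · obtain ⟨j', h1', h2', rfl⟩ := seg_mem hv
          exact hc'.ne (by omega) (by omega)
      · rw [seg_last _ _ (by omega), hm]
        have := (heven (a + 1) (by omega)).symm
        simp
        rwa [show 1 - (-b + (b - a)) = a + 1 by ring]
    have := hN _ hl (by simp [seg_length]; omega) (by
      have hne : seg c' (b + 1) (2 * h - m) ≠ [] := by
        intro hs; have := seg_length (c := c') (b + 1) (2 * h - m); rw [hs] at this; simp at this; omega
      rw [List.getLast?_append_of_ne_nil _ (by simp), List.getLast?_append_of_ne_nil _ hne,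
        seg_last _ _ (by omega), List.head?_append_of_ne_nil _ (by
        intro hs; have := seg_length (c := fun i => c' (-i)) (-b) m; rw [hs] at this; simp at this; omega),
        seg_head _ _ (by omega)]
      have h5 : b + 1 + ((2 * h - m : ℕ) : ℤ) - 1 = a + 2 * h := by omega
      rw [h5, hc'.per]
      simpa using hadj)
    simp [seg_length] at this
    omega
  refine sub_S ((Finset.range h).image (fun i : ℕ => c' (2 * i))) ?_ ?_
  · rw [Finset.card_image_of_injOn, Finset.card_range]
    intro a ha b hb hab
    simp at ha hb
    rcases lt_trichotomy a b with hl | hl | hl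
    · exact absurd hab (hc'.ne (by omega) (by omega))
    · exact hl
    · exact absurd hab.symm (hc'.ne (by omega) (by omega))
  · have hmem : ∀ i : ℤ, 2 ∣ i → c' i ∈ (Finset.range h).image (fun i : ℕ => c' (2 * i)) := by
      intro i hi
      obtain ⟨j, h1, h2, h3⟩ := hc'.rep (by omega) 0 i
      have h4 := (hc'.2 _ _).1 h3
      have h5 : (2 : ℤ) ∣ j - i := dvd_trans ⟨h, by ring⟩ h4
      rw [Finset.mem_image]
      refine ⟨(j / 2).toNat, by simp; omega, ?_⟩
      rw [← h3]; congr 1; omega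
    have main : ∀ i b, G.Adj (c' i) b → c' i ∈ (Finset.range h).image (fun i : ℕ => c' (2 * i)) ∨
        b ∈ (Finset.range h).image (fun i : ℕ => c' (2 * i)) := by
      intro i b hab
      by_cases hi : 2 ∣ i
      · exact Or.inl (hmem i hi)
      right
      by_cases hb : ∀ j, b ≠ c' j
      · exact absurd (hR b hb i hab.symm) hi
      · push Not at hb
        obtain ⟨j, rfl⟩ := hb
        obtain ⟨j', h1, h2, h3⟩ := hc'.rep (by omega) i j
        rw [← h3] at hab ⊢
        apply hmem
        by_contra hj
        have : i ≠ j' := by rintro rfl; exact hab.ne rfl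
        exact hCC i j' (by omega) (by omega) (by omega) (by omega) hab
    intro a b hab
    by_cases ha : ∀ i, a ≠ c' i
    · obtain ⟨j, rfl⟩ := hiso' a ha b hab
      exact (main j a hab.symm).symm
    · push Not at ha
      obtain ⟨i, rfl⟩ := ha
      exact main i b hab

end three

theorem sub_K {V : Type*} {G : SimpleGraph V} [Fintype V] [DecidableEq V] (x y : V) (hxy : x ≠ y)
    (hm : ∀ v, v ≠ x → v ≠ y → ∃ w, w ≠ x ∧ w ≠ y ∧ G.Adj v w ∧
      ∀ w', w' ≠ x → w' ≠ y → G.Adj v w' → w' = w) :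
    ∃ m, Fintype.card V = 2 + 2 * m ∧ SubgraphOf G (KjoinMK2 2 m) := by
  classical
  let W := {v : V // v ≠ x ∧ v ≠ y}
  have hσ : ∀ v : W, ∃ w : W, G.Adj v.1 w.1 ∧ ∀ w' : W, G.Adj v.1 w'.1 → w' = w := by
    rintro ⟨v, h1, h2⟩
    obtain ⟨w, h3, h4, h5, h6⟩ := hm v h1 h2
    exact ⟨⟨w, h3, h4⟩, h5, fun w' hw' => Subtype.ext (h6 _ w'.2.1 w'.2.2 hw')⟩
  choose σ hσ1 hσ2 using hσ
  have hinv : ∀ v, σ (σ v) = v := fun v => (hσ2 (σ v) v (hσ1 v).symm).symm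
  have hne : ∀ v, σ v ≠ v := fun v he => by
    have := hσ1 v
    rw [he] at this
    exact this.ne rfl
  let e0 := Fintype.equivFin W
  let T := {w : W // e0 w < e0 (σ w)}
  let F : T × Fin 2 → W := fun p => if p.2 = 0 then p.1.1 else σ p.1.1
  have hF : Function.Bijective F := by
    constructor
    · rintro ⟨⟨t, ht⟩, a⟩ ⟨⟨u, hu⟩, b⟩ hab
      have key : t = σ u → False := by
        rintro rfl
        rw [hinv] at ht
        exact absurd ht (not_lt.2 hu.le)
      have key2 : σ t = u → False := by
        rintro rfl
        rw [hinv] at hu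
        exact absurd hu (not_lt.2 ht.le)
      fin_cases a <;> fin_cases b <;> simp [F] at hab
      · subst hab; rfl
      · exact (key hab).elim
      · exact (key2 hab).elim
      · have : t = u := by rw [← hinv t, hab, hinv]
        subst this; rfl
    · intro w
      by_cases hw : e0 w < e0 (σ w)
      · exact ⟨(⟨w, hw⟩, 0), by simp [F]⟩
      · have h1 : e0 (σ w) < e0 w := lt_of_le_of_ne (not_lt.1 hw)
          (fun he => hne w (e0.injective he))
        exact ⟨(⟨σ w, by rw [hinv]; exact h1⟩, 1), by simp [F, hinv]⟩
  let E := Equiv.ofBijective F hF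
  let m := Fintype.card T
  let eT := Fintype.equivFin T
  have hEσ : ∀ w, (E.symm (σ w)).1 = (E.symm w).1 := by
    intro w
    obtain ⟨⟨t, a⟩, rfl⟩ := E.surjective w
    rw [Equiv.symm_apply_apply]
    fin_cases a
    · have : σ (E (t, 0)) = E (t, 1) := by simp [E, F]
      change (E.symm (σ (E (t, 0)))).1 = t
      rw [this, Equiv.symm_apply_apply]
    · have : σ (E (t, 1)) = E (t, 0) := by simp [E, F, hinv]
      change (E.symm (σ (E (t, 1)))).1 = t
      rw [this, Equiv.symm_apply_apply]
  have hcW : Fintype.card W = 2 * m := by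
    rw [← Fintype.card_congr E, Fintype.card_prod, Fintype.card_fin, mul_comm]
  have hcV : Fintype.card V = 2 + 2 * m := by
    rw [← hcW, Fintype.card_subtype]
    have h1 : (Finset.univ.filter fun v : V => v ≠ x ∧ v ≠ y) = Finset.univ \ {x, y} := by
      ext v; simp
    rw [h1, Finset.card_sdiff_of_subset (Finset.subset_univ _), Finset.card_pair hxy,
      Finset.card_univ]
    have := Finset.card_le_univ ({x, y} : Finset V)
    rw [Finset.card_pair hxy] at this
    omega
  refine ⟨m, hcV, ?_⟩
  let g0 : V → ℕ := fun v => if hx : v = x then 0 else if hy : v = y then 1 else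
    2 + (2 * (eT (E.symm ⟨v, hx, hy⟩).1).val + (E.symm ⟨v, hx, hy⟩).2.val)
  have gx : g0 x = 0 := by simp [g0]
  have gy : g0 y = 1 := by simp [g0, hxy.symm]
  have gw : ∀ w : W, g0 w.1 = 2 + (2 * (eT (E.symm w).1).val + (E.symm w).2.val) := by
    rintro ⟨w, h1, h2⟩
    simp [g0, h1, h2]
  have hcase : ∀ v : V, v = x ∨ v = y ∨ ∃ w : W, w.1 = v := by
    intro v
    by_cases h1 : v = x
    · exact Or.inl h1
    by_cases h2 : v = y
    · exact Or.inr (Or.inl h2)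
    exact Or.inr (Or.inr ⟨⟨v, h1, h2⟩, rfl⟩)
  have hlt : ∀ v, g0 v < 2 + 2 * m := by
    intro v
    rcases hcase v with rfl | rfl | ⟨w, rfl⟩
    · rw [gx]; omega
    · rw [gy]; omega
    · rw [gw]
      have h1 := (eT (E.symm w).1).2
      have h2 := (E.symm w).2.2
      have h3 : (eT (E.symm w).1).val < m := h1
      omega
  have hinj : Function.Injective g0 := by
    intro u v huv
    rcases hcase u with rfl | rfl | ⟨w, rfl⟩ <;> rcases hcase v with rfl | rfl | ⟨w', rfl⟩
    · rfl
    · rw [gx, gy] at huv; omega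
    · rw [gx, gw] at huv; omega
    · rw [gx, gy] at huv; omega
    · rfl
    · rw [gy, gw] at huv; omega
    · rw [gx, gw] at huv; omega
    · rw [gy, gw] at huv; omega
    · rw [gw, gw] at huv
      have h1 := (E.symm w).2.2
      have h2 := (E.symm w').2.2
      have h3 : (eT (E.symm w).1).val = (eT (E.symm w').1).val := by omega
      have h4 : (E.symm w).2.val = (E.symm w').2.val := by omega
      have h5 : E.symm w = E.symm w' :=
        Prod.ext (eT.injective (Fin.ext h3)) (Fin.ext h4)
      rw [E.symm.injective h5]
  refine ⟨⟨fun v => ⟨g0 v, hlt v⟩, fun u v huv => hinj (Fin.mk.inj huv)⟩, fun u v huv => ?_⟩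
  rw [KjoinMK2, SimpleGraph.fromRel_adj]
  refine ⟨fun he => huv.ne (hinj (Fin.mk.inj he)), ?_⟩
  change (g0 u < 2 ∨ (g0 u - 2) / 2 = (g0 v - 2) / 2) ∨ (g0 v < 2 ∨ (g0 v - 2) / 2 = (g0 u - 2) / 2)
  rcases hcase u with rfl | rfl | ⟨w, rfl⟩
  · rw [gx]; simp
  · rw [gy]; simp
  rcases hcase v with rfl | rfl | ⟨w', rfl⟩
  · rw [gx]; simp
  · rw [gy]; simp
  left; right
  have := hσ2 w w' huv
  subst this
  rw [gw, gw, hEσ]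
  have h1 := (E.symm w).2.2
  have h2 := (E.symm (σ w)).2.2
  omega
section five
variable {V : Type*} {G : SimpleGraph V} {h : ℕ} {c : ℤ → V}

theorem exists_out [Fintype V] (hc : Cyc G h c) (hh : 0 < h) (l : List V)
    (hcard : 2 * h + l.length < Fintype.card V) : ∃ z, (∀ i, z ≠ c i) ∧ z ∉ l := by
  classical
  set F : Finset V := (Finset.Ico (0:ℤ) (0 + 2 * h)).image c ∪ l.toFinset with hF
  have h1 : F.card < Fintype.card V := by
    have a1 := Finset.card_union_le ((Finset.Ico (0:ℤ) (0 + 2 * h)).image c) l.toFinset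
    have a2 := Finset.card_image_le (s := Finset.Ico (0:ℤ) (0 + 2 * h)) (f := c)
    have a3 := l.toFinset_card_le
    rw [Int.card_Ico] at a2
    rw [← hF] at a1
    omega
  obtain ⟨z, hz⟩ : ∃ z, z ∉ F := by
    by_contra hn
    push Not at hn
    have : F = Finset.univ := Finset.eq_univ_iff_forall.2 hn
    rw [this, Finset.card_univ] at h1
    omega
  refine ⟨z, fun i hi => hz ?_, fun hl => hz ?_⟩
  · obtain ⟨j, h1, h2, h3⟩ := hc.rep hh 0 i
    rw [hF, Finset.mem_union]
    left
    rw [Finset.mem_image]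
    exact ⟨j, by simp; omega, by rw [h3, hi]⟩
  · rw [hF, Finset.mem_union]
    right
    simpa using hl

theorem forest_hook (hc : Cyc G h c) (hh : 0 < h) {w : V} (hw : ∀ i, w ≠ c i) {i : ℤ}
    (hwi : G.Adj w (c i)) {q : List V} (hq : RPth G c q) (hwq : w ∉ q) {m₁ m₂ : ℕ}
    (h1 : m₁ ≤ 2 * h + 1) (h2 : m₂ ≤ q.length) : ContainsForest G ![m₁, m₂] := by
  have hp : Pth G ([w] ++ seg c i (2 * h)) := by
    refine Pth.append ⟨by simp, by simp⟩ (seg_pth hc i _ le_rfl) ?_ ?_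
    · intro a ha b hb
      obtain ⟨j, -, -, rfl⟩ := seg_mem hb
      simp at ha
      subst ha
      exact hw j
    · intro a ha b hb
      rw [seg_head i _ (by omega)] at hb
      simp at ha hb
      subst ha hb
      exact hwi
  refine forest_of_lists hp hq.1 ?_ (by simp [seg_length]; omega) h2
  intro a ha b hb hab
  subst hab
  rw [List.mem_append] at ha
  rcases ha with ha | ha
  · simp at ha
    subst ha
    exact hwq hb
  · obtain ⟨j, -, -, rfl⟩ := seg_mem ha
    exact hq.2 _ hb j rfl

theorem item1 [Fintype V] [DecidableEq V] [DecidableRel G.Adj] (hc : Cyc G h c) (hh : 3 ≤ h)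
    (hconn : G.Connected) (hcard : 2 * h + 4 ≤ Fintype.card V) (hδ : ∀ v, h ≤ G.degree v)
    {p : List V} (hp : RPth G c p) (hk : 3 ≤ p.length) :
    ContainsForest G ![2 * h + 1, 3] := by
  by_cases hu : ∀ u, (∀ i, u ≠ c i) → ∃ i, G.Adj u (c i)
  · obtain ⟨w, hw, hwp⟩ := exists_out hc (by omega) (p.take 3) (by simp; omega)
    obtain ⟨i, hi⟩ := hu w hw
    exact forest_hook hc (by omega) hw hi (q := p.take 3)
      ⟨hp.1.take 3, fun v hv => hp.2 v (List.mem_of_mem_take hv)⟩ hwp le_rfl (by simp; omega)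
  · push Not at hu
    obtain ⟨u, hu, hun⟩ := hu
    obtain ⟨x, w, ⟨i, rfl⟩, hw, hadj⟩ := exists_cross hconn (Set.range c) (x := c 0) (y := u) ⟨0, rfl⟩
      (by rintro ⟨i, hi⟩; exact hu i hi.symm)
    have hw' : ∀ i, w ≠ c i := fun i hi => hw ⟨i, hi.symm⟩
    have hcd : 1 < ((G.neighborFinset u).erase w).card := by
      have := Finset.pred_card_le_card_erase (s := G.neighborFinset u) (a := w)
      rw [SimpleGraph.card_neighborFinset_eq_degree] at this
      have := hδ u
      omega
    obtain ⟨a, ha, b, hb, hab⟩ := Finset.one_lt_card.1 hcd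
    simp at ha hb
    have hR : ∀ z, G.Adj u z → ∀ i, z ≠ c i := fun z hz i hi => hun i (hi ▸ hz)
    refine forest_hook hc (by omega) hw' hadj.symm (q := [a, u, b]) ⟨⟨?_, ?_⟩, ?_⟩ ?_ le_rfl (by simp)
    · simp [ha.2.symm, hb.2]
    · simp [ha.2.ne', hb.2.ne, hab]
    · simp
      exact ⟨hR a ha.2, hu, hR b hb.2⟩
    · simp
      refine ⟨fun e => ha.1 e.symm, fun e => ?_, fun e => hb.1 e.symm⟩
      subst e
      exact hun i hadj.symm

end five
section six
variable {V : Type*} {G : SimpleGraph V} {h : ℕ} {c : ℤ → V}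

theorem hook_pth (hc : Cyc G h c) (hh : 0 < h) {p : List V} (hp : RPth G c p) {a : V}
    (ha : p.getLast? = some a) {i : ℤ} (hai : G.Adj a (c i)) : Pth G (p ++ seg c i (2 * h)) := by
  refine Pth.append hp.1 (seg_pth hc i _ le_rfl) ?_ ?_
  · intro a ha b hb
    obtain ⟨j, -, -, rfl⟩ := seg_mem hb
    exact hp.2 a ha j
  · intro x hx b hb
    rw [seg_head i _ (by omega)] at hb
    rw [ha] at hx
    simp at hx hb
    subst hx hb
    exact hai

theorem hook_forest (hc : Cyc G h c) (hh : 0 < h) {p : List V} (hp : RPth G c p) {a : V}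
    (ha : p.getLast? = some a) {i : ℤ} (hai : G.Adj a (c i)) {m₁ m₂ : ℕ}
    (hm : m₁ + m₂ ≤ p.length + 2 * h) : ContainsForest G ![m₁, m₂] :=
  forest_of_list (hook_pth hc hh hp ha hai) (by rw [List.length_append, seg_length]; exact hm)

/-- closed longest path in the remainder with a vertex adjacent to something outside -/
theorem closed_out {p : List V} (hp : RPth G c p) (hmax : ∀ q, RPth G c q → q.length ≤ p.length)
    (hcl : ∀ x ∈ p.getLast?, ∀ y ∈ p.head?, G.Adj x y) {u : V} (hu : u ∈ p) :
    ∃ q, RPth G c q ∧ q.length = p.length ∧ q.getLast? = some u ∧ ∀ v ∈ q, v ∈ p := by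
  obtain ⟨s, t, rfl⟩ := List.append_of_mem hu
  have e : s ++ u :: t = (s ++ [u]) ++ t := by simp
  refine ⟨t ++ (s ++ [u]), ⟨?_, ?_⟩, ?_, ?_, ?_⟩
  · by_cases ht : t = []
    · subst ht
      simpa using hp.1
    · apply Pth.rot
      · rw [← e]; exact hp.1
      · intro x hx y hy
        apply hcl
        · rw [e, List.getLast?_append_of_ne_nil _ ht]
          exact hx
        · rw [e, List.head?_append_of_ne_nil _ (by simp)]
          exact hy
  · intro v hv
    apply hp.2
    simp at hv ⊢
    tauto
  · simp; omega
  · rw [← List.append_assoc]; simp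
  · intro v hv; simp at hv ⊢; tauto

theorem closed_nbr {p : List V} (hp : RPth G c p) (hmax : ∀ q, RPth G c q → q.length ≤ p.length)
    (hcl : ∀ x ∈ p.getLast?, ∀ y ∈ p.head?, G.Adj x y) {u z : V} (hu : u ∈ p) (hz : z ∉ p)
    (huz : G.Adj u z) : ∃ i, z = c i := by
  by_contra hn
  push Not at hn
  obtain ⟨q, hq, hql, hqu, hqs⟩ := closed_out hp hmax hcl hu
  have := max_head hq.reverse (by simpa [hql] using hmax) (a := u) (by simpa using hqu) huz hn
  exact hz (hqs z (by simpa using this))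

theorem itemA [Fintype V] [DecidableEq V] [DecidableRel G.Adj] (hc : Cyc G h c) (hh : 3 ≤ h)
    (hconn : G.Connected) (hδ : ∀ v, h ≤ G.degree v)
    {p : List V} (hp : RPth G c p) (hmax : ∀ q, RPth G c q → q.length ≤ p.length)
    (hk : p.length = h + 1) {m₁ m₂ : ℕ} (hm : m₁ + m₂ ≤ 3 * h + 1) :
    ContainsForest G ![m₁, m₂] := by
  obtain ⟨a, ha⟩ : ∃ a, p.head? = some a := by
    cases p with
    | nil => simp at hk
    | cons a t => exact ⟨a, rfl⟩
  obtain ⟨b, hb⟩ : ∃ b, p.getLast? = some b := by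
    cases p with
    | nil => simp at hk
    | cons a t => exact ⟨_, List.getLast?_eq_some_getLast (by simp)⟩
  by_cases hi : ∃ i, G.Adj a (c i)
  · obtain ⟨i, hi⟩ := hi
    exact hook_forest hc (by omega) hp.reverse (a := a) (by simpa using ha) hi (by simp; omega)
  · push Not at hi
    have hba : b ≠ a := by
      rintro rfl
      have hp1 := hp.1.2
      match p, hk with
      | x :: y :: t, _ =>
        simp at ha
        subst ha
        rw [List.getLast?_cons_cons] at hb
        exact (List.nodup_cons.1 hp1).1 (List.mem_of_getLast? hb)
      | [x], hk => simp at hk; omega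
    have hab : G.Adj a b := by
      by_contra hn
      have h1 : G.neighborFinset a ⊆ (p.toFinset.erase a).erase b := by
        intro z hz
        rw [SimpleGraph.mem_neighborFinset] at hz
        have : z ∈ p := max_head hp hmax ha hz (fun i e => hi i (e ▸ hz))
        simp
        exact ⟨fun e => hn (e ▸ hz), hz.ne', this⟩
      have h2 := Finset.card_le_card h1
      rw [SimpleGraph.card_neighborFinset_eq_degree, Finset.card_erase_of_mem, Finset.card_erase_of_mem,
        List.toFinset_card_of_nodup hp.1.2] at h2
      · have := hδ a
        omega
      · simpa using List.mem_of_head? ha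
      · simp [hba]
        exact List.mem_of_getLast? hb
    obtain ⟨u, z, hu, hz, huz⟩ := exists_cross hconn {v | v ∈ p} (x := a) (y := c 0)
      (List.mem_of_head? ha) (fun h0 => hp.2 _ h0 0 rfl)
    have hcl : ∀ x ∈ p.getLast?, ∀ y ∈ p.head?, G.Adj x y := by
      intro x hx y hy
      rw [hb] at hx
      rw [ha] at hy
      simp at hx hy
      subst hx hy
      exact hab.symm
    obtain ⟨i, rfl⟩ := closed_nbr hp hmax hcl hu hz huz
    obtain ⟨q, hq, hql, hqu, hqs⟩ := closed_out hp hmax hcl hu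
    exact hook_forest hc (by omega) hq hqu huz (by omega)

end six
section seven
variable {V : Type*} {G : SimpleGraph V} {h : ℕ} {c : ℤ → V}

theorem Cyc.adj' (hc : Cyc G h c) (i j : ℤ) (hij : (2 * h : ℤ) ∣ j - (i + 1)) :
    G.Adj (c i) (c j) := by
  have := hc.1 i
  rwa [← (hc.2 j (i + 1)).2 hij] at this

theorem Cyc.ne' (hc : Cyc G h c) (i j : ℤ) (hij : ¬ (2 * h : ℤ) ∣ i - j) : c i ≠ c j :=
  fun e => hij ((hc.2 i j).1 e)

theorem s3 (hc : Cyc G 3 c) {p q r z : V} (hp : ∀ i, p ≠ c i) (hq : ∀ i, q ≠ c i)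
    (hr : ∀ i, r ≠ c i) (hz : ∀ i, z ≠ c i) (hpq : G.Adj p q) (hqr : G.Adj q r) (hpr : p ≠ r)
    (hzp : z ≠ p) (hzq : z ≠ q) (hzr : z ≠ r) (h0 : G.Adj r (c 0)) (i : ℤ) (hi : ¬ (6:ℤ) ∣ i - 3)
    (hzi : G.Adj z (c i)) : ContainsForest G ![5, 5] := by
  have e0 : G.Adj (c 0) (c 1) := hc.adj' _ _ (by norm_num)
  have e1 : G.Adj (c 1) (c 2) := hc.adj' _ _ (by norm_num)
  have e2 : G.Adj (c 2) (c 3) := hc.adj' _ _ (by norm_num)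
  have e3 : G.Adj (c 3) (c 4) := hc.adj' _ _ (by norm_num)
  have e4 : G.Adj (c 4) (c 5) := hc.adj' _ _ (by norm_num)
  have e5 : G.Adj (c 5) (c 0) := hc.adj' _ _ (by norm_num)
  have hcc : ∀ i j, c i = c j ↔ (6:ℤ) ∣ i - j := by simpa using hc.2
  obtain ⟨j, j1, j2, j3⟩ := hc.rep (by norm_num) 0 i
  rw [← j3] at hzi
  have hj : ¬ (6:ℤ) ∣ j - 3 := by
    have := (hcc j i).1 j3
    omega
  clear hi j3
  have sy : ∀ i, G.Adj z (c i) → G.Adj (c i) z := fun i h => h.symm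
  have hq' : ∀ i, c i ≠ q := fun i => (hq i).symm
  have hp' : ∀ i, c i ≠ p := fun i => (hp i).symm
  have hr' : ∀ i, c i ≠ r := fun i => (hr i).symm
  have hz' : ∀ i, c i ≠ z := fun i => (hz i).symm
  norm_num at j2
  interval_cases j
  · refine forest_of_lists (l₁ := [p, q, r, c 0, z]) (l₂ := [c 1, c 2, c 3, c 4, c 5]) ⟨?_, ?_⟩ ⟨?_, ?_⟩ ?_ le_rfl le_rfl <;> norm_num [*, hzi.symm, hpq.ne, hqr.ne, hzp.symm, hzq.symm, hzr.symm]
  · refine forest_of_lists (l₁ := [p, q, r, c 0, c 5]) (l₂ := [z, c 1, c 2, c 3, c 4]) ⟨?_, ?_⟩ ⟨?_, ?_⟩ ?_ le_rfl le_rfl <;> norm_num [*, e5.symm, hpq.ne, hqr.ne, hzp.symm, hzq.symm, hzr.symm]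
  · refine forest_of_lists (l₁ := [p, q, r, c 0, c 1]) (l₂ := [z, c 2, c 3, c 4, c 5]) ⟨?_, ?_⟩ ⟨?_, ?_⟩ ?_ le_rfl le_rfl <;> norm_num [*, e5.symm, hpq.ne, hqr.ne, hzp.symm, hzq.symm, hzr.symm]
  · norm_num at hj
  · refine forest_of_lists (l₁ := [p, q, r, c 0, c 5]) (l₂ := [z, c 4, c 3, c 2, c 1]) ⟨?_, ?_⟩ ⟨?_, ?_⟩ ?_ le_rfl le_rfl <;> norm_num [*, e5.symm, e1.symm, e2.symm, e3.symm, hpq.ne, hqr.ne, hzp.symm, hzq.symm, hzr.symm]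
  · refine forest_of_lists (l₁ := [p, q, r, c 0, c 1]) (l₂ := [z, c 5, c 4, c 3, c 2]) ⟨?_, ?_⟩ ⟨?_, ?_⟩ ?_ le_rfl le_rfl <;> norm_num [*, e4.symm, e2.symm, e3.symm, hpq.ne, hqr.ne, hzp.symm, hzq.symm, hzr.symm]

theorem s3' (hc : Cyc G 3 c) {p q r z w : V} (hp : ∀ i, p ≠ c i) (hq : ∀ i, q ≠ c i)
    (hr : ∀ i, r ≠ c i) (hz : ∀ i, z ≠ c i) (hw : ∀ i, w ≠ c i)
    (hpq : G.Adj p q) (hqr : G.Adj q r) (hpr : p ≠ r)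
    (hzp : z ≠ p) (hzq : z ≠ q) (hzr : z ≠ r) (hwp : w ≠ p) (hwq : w ≠ q) (hwr : w ≠ r)
    (h0 : G.Adj r (c 0)) (hzi : G.Adj z (c 3)) (hwz : G.Adj w z) : ContainsForest G ![5, 5] := by
  have e0 : G.Adj (c 0) (c 1) := hc.adj' _ _ (by norm_num)
  have e3 : G.Adj (c 3) (c 4) := hc.adj' _ _ (by norm_num)
  have e4 : G.Adj (c 4) (c 5) := hc.adj' _ _ (by norm_num)
  have hcc : ∀ i j, c i = c j ↔ (6:ℤ) ∣ i - j := by simpa using hc.2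
  have hq' : ∀ i, c i ≠ q := fun i => (hq i).symm
  have hp' : ∀ i, c i ≠ p := fun i => (hp i).symm
  have hr' : ∀ i, c i ≠ r := fun i => (hr i).symm
  have hz' : ∀ i, c i ≠ z := fun i => (hz i).symm
  have hw' : ∀ i, c i ≠ w := fun i => (hw i).symm
  refine forest_of_lists (l₁ := [p, q, r, c 0, c 1]) (l₂ := [w, z, c 3, c 4, c 5]) ⟨?_, ?_⟩ ⟨?_, ?_⟩ ?_ le_rfl le_rfl <;> norm_num [*, hpq.ne, hqr.ne, hwz.ne, hzp.symm, hzq.symm, hzr.symm, hwp.symm, hwq.symm, hwr.symm]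

theorem s4 (hc : Cyc G 4 c) {p q r z : V} (hp : ∀ i, p ≠ c i) (hq : ∀ i, q ≠ c i)
    (hr : ∀ i, r ≠ c i) (hz : ∀ i, z ≠ c i) (hpq : G.Adj p q) (hqr : G.Adj q r) (hpr : p ≠ r)
    (hzp : z ≠ p) (hzq : z ≠ q) (hzr : z ≠ r) (h0 : G.Adj r (c 0)) (h4 : G.Adj r (c 4))
    (i : ℤ) (hi : ¬ (4:ℤ) ∣ i - 2)
    (hzi : G.Adj z (c i)) : ContainsForest G ![7, 5] := by
  have e0 : G.Adj (c 0) (c 1) := hc.adj' _ _ (by norm_num)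
  have e1 : G.Adj (c 1) (c 2) := hc.adj' _ _ (by norm_num)
  have e2 : G.Adj (c 2) (c 3) := hc.adj' _ _ (by norm_num)
  have e3 : G.Adj (c 3) (c 4) := hc.adj' _ _ (by norm_num)
  have e4 : G.Adj (c 4) (c 5) := hc.adj' _ _ (by norm_num)
  have e5 : G.Adj (c 5) (c 6) := hc.adj' _ _ (by norm_num)
  have e6 : G.Adj (c 6) (c 7) := hc.adj' _ _ (by norm_num)
  have e7 : G.Adj (c 7) (c 0) := hc.adj' _ _ (by norm_num)
  have hcc : ∀ i j, c i = c j ↔ (8:ℤ) ∣ i - j := by simpa using hc.2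
  obtain ⟨j, j1, j2, j3⟩ := hc.rep (by norm_num) 0 i
  rw [← j3] at hzi
  have hj : ¬ (4:ℤ) ∣ j - 2 := by
    have := (hcc j i).1 j3
    omega
  clear hi j3
  have hq' : ∀ i, c i ≠ q := fun i => (hq i).symm
  have hp' : ∀ i, c i ≠ p := fun i => (hp i).symm
  have hr' : ∀ i, c i ≠ r := fun i => (hr i).symm
  have hz' : ∀ i, c i ≠ z := fun i => (hz i).symm
  norm_num at j2
  interval_cases j
  · refine forest_of_lists (l₂ := [p, q, r, c 0, z]) (l₁ := [c 1, c 2, c 3, c 4, c 5, c 6, c 7]) ⟨?_, ?_⟩ ⟨?_, ?_⟩ ?_ le_rfl le_rfl <;> norm_num [*, hzi.symm, hpq.ne, hqr.ne, hzp.symm, hzq.symm, hzr.symm]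
  · refine forest_of_lists (l₂ := [z, c 1, c 2, c 3, c 4]) (l₁ := [p, q, r, c 0, c 7, c 6, c 5]) ⟨?_, ?_⟩ ⟨?_, ?_⟩ ?_ le_rfl le_rfl <;> norm_num [*, e5.symm, e6.symm, e7.symm, hpq.ne, hqr.ne, hzp.symm, hzq.symm, hzr.symm]
  · norm_num at hj
  · refine forest_of_lists (l₂ := [z, c 3, c 2, c 1, c 0]) (l₁ := [p, q, r, c 4, c 5, c 6, c 7]) ⟨?_, ?_⟩ ⟨?_, ?_⟩ ?_ le_rfl le_rfl <;> norm_num [*, e0.symm, e1.symm, e2.symm, hpq.ne, hqr.ne, hzp.symm, hzq.symm, hzr.symm]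
  · refine forest_of_lists (l₂ := [p, q, r, c 4, z]) (l₁ := [c 5, c 6, c 7, c 0, c 1, c 2, c 3]) ⟨?_, ?_⟩ ⟨?_, ?_⟩ ?_ le_rfl le_rfl <;> norm_num [*, hzi.symm, hpq.ne, hqr.ne, hzp.symm, hzq.symm, hzr.symm]
  · refine forest_of_lists (l₂ := [z, c 5, c 6, c 7, c 0]) (l₁ := [p, q, r, c 4, c 3, c 2, c 1]) ⟨?_, ?_⟩ ⟨?_, ?_⟩ ?_ le_rfl le_rfl <;> norm_num [*, e1.symm, e2.symm, e3.symm, hpq.ne, hqr.ne, hzp.symm, hzq.symm, hzr.symm]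
  · norm_num at hj
  · refine forest_of_lists (l₂ := [z, c 7, c 6, c 5, c 4]) (l₁ := [p, q, r, c 0, c 1, c 2, c 3]) ⟨?_, ?_⟩ ⟨?_, ?_⟩ ?_ le_rfl le_rfl <;> norm_num [*, e4.symm, e5.symm, e6.symm, hpq.ne, hqr.ne, hzp.symm, hzq.symm, hzr.symm]

/-- here `j = 2` or `j = 6` -/
theorem s4' (hc : Cyc G 4 c) {p q r z w : V} (hp : ∀ i, p ≠ c i) (hq : ∀ i, q ≠ c i)
    (hr : ∀ i, r ≠ c i) (hz : ∀ i, z ≠ c i) (hw : ∀ i, w ≠ c i)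
    (hpq : G.Adj p q) (hqr : G.Adj q r) (hpr : p ≠ r)
    (hzp : z ≠ p) (hzq : z ≠ q) (hzr : z ≠ r) (hwp : w ≠ p) (hwq : w ≠ q) (hwr : w ≠ r)
    (h0 : G.Adj r (c 0)) (h4 : G.Adj r (c 4)) (i : ℤ) (hi : (4:ℤ) ∣ i - 2)
    (hzi : G.Adj z (c i)) (hwz : G.Adj w z) :
    ContainsForest G ![7, 5] := by
  have e0 : G.Adj (c 0) (c 1) := hc.adj' _ _ (by norm_num)
  have e1 : G.Adj (c 1) (c 2) := hc.adj' _ _ (by norm_num)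
  have e2 : G.Adj (c 2) (c 3) := hc.adj' _ _ (by norm_num)
  have e3 : G.Adj (c 3) (c 4) := hc.adj' _ _ (by norm_num)
  have e4 : G.Adj (c 4) (c 5) := hc.adj' _ _ (by norm_num)
  have e5 : G.Adj (c 5) (c 6) := hc.adj' _ _ (by norm_num)
  have e6 : G.Adj (c 6) (c 7) := hc.adj' _ _ (by norm_num)
  have e7 : G.Adj (c 7) (c 0) := hc.adj' _ _ (by norm_num)
  have hcc : ∀ i j, c i = c j ↔ (8:ℤ) ∣ i - j := by simpa using hc.2
  have hq' : ∀ i, c i ≠ q := fun i => (hq i).symm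
  have hp' : ∀ i, c i ≠ p := fun i => (hp i).symm
  have hr' : ∀ i, c i ≠ r := fun i => (hr i).symm
  have hz' : ∀ i, c i ≠ z := fun i => (hz i).symm
  have hw' : ∀ i, c i ≠ w := fun i => (hw i).symm
  have hor : c i = c 2 ∨ c i = c 6 := by
    rw [hcc, hcc]
    omega
  rcases hor with e | e <;> rw [e] at hzi <;> clear e hi
  · refine forest_of_lists (l₂ := [w, z, c 2, c 3, c 4]) (l₁ := [p, q, r, c 0, c 7, c 6, c 5]) ⟨?_, ?_⟩ ⟨?_, ?_⟩ ?_ le_rfl le_rfl <;> norm_num [*, e5.symm, e6.symm, e7.symm, hpq.ne, hqr.ne, hwz.ne, hzp.symm, hzq.symm, hzr.symm, hwp.symm, hwq.symm, hwr.symm]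
  · refine forest_of_lists (l₂ := [w, z, c 6, c 7, c 0]) (l₁ := [p, q, r, c 4, c 3, c 2, c 1]) ⟨?_, ?_⟩ ⟨?_, ?_⟩ ?_ le_rfl le_rfl <;> norm_num [*, e1.symm, e2.symm, e3.symm, hpq.ne, hqr.ne, hwz.ne, hzp.symm, hzq.symm, hzr.symm, hwp.symm, hwq.symm, hwr.symm]

end seven
section eight
variable {V : Type*} {G : SimpleGraph V} {h : ℕ} {c : ℤ → V}

theorem RPth.shift_iff (s : ℤ) (q : List V) : RPth G (fun i => c (i + s)) q ↔ RPth G c q := by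
  constructor
  · rintro ⟨h1, h2⟩
    refine ⟨h1, fun v hv i => ?_⟩
    have := h2 v hv (i - s)
    simpa using this
  · rintro ⟨h1, h2⟩
    exact ⟨h1, fun v hv i => h2 v hv (i + s)⟩

theorem close_deg [Fintype V] [DecidableEq V] [DecidableRel G.Adj] (hc : Cyc G h c) (hh : 0 < h)
    (hδ : ∀ v, h ≤ G.degree v)
    {p : List V} (hp : RPth G c p) (hmax : ∀ q, RPth G c q → q.length ≤ p.length)
    {a b : V} (ha : p.head? = some a) (hb : p.getLast? = some b) (hab : a ≠ b)
    (W : Finset ℤ) (hW : ∀ i : ℤ, 0 ≤ i → i < 2 * h → G.Adj a (c i) → i ∈ W)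
    (hk2 : 2 ≤ p.length) (hk : p.length + W.card < h + 2) : ∀ x ∈ p.getLast?, ∀ y ∈ p.head?, G.Adj x y := by
  have hadj : G.Adj a b := by
    by_contra hn
    have h1 := deg_count hc hh a (hδ a) ((p.toFinset.erase a).erase b) (fun z hz hzc => by
      have : z ∈ p := max_head hp hmax ha hz hzc
      simp
      exact ⟨fun e => hn (e ▸ hz), hz.ne', this⟩) 0
    have h2 : ((Finset.Ico (0:ℤ) (0 + 2 * h)).filter (fun i => G.Adj a (c i))).card ≤ W.card := by
      apply Finset.card_le_card
      intro i hi
      simp at hi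
      exact hW i hi.1.1 hi.1.2 hi.2
    have am : a ∈ p.toFinset := by simpa using List.mem_of_head? ha
    have bm : b ∈ p.toFinset.erase a := by
      simp [hab.symm]
      exact List.mem_of_getLast? hb
    rw [Finset.card_erase_of_mem bm, Finset.card_erase_of_mem am,
        List.toFinset_card_of_nodup hp.1.2] at h1
    omega
  intro x hx y hy
  rw [hb] at hx
  rw [ha] at hy
  simp at hx hy
  subst hx hy
  exact hadj.symm

/-- common end game -/
theorem endgame [Fintype V] [DecidableEq V] [DecidableRel G.Adj] (hc : Cyc G h c) (hh : 3 ≤ h)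
    (hconn : G.Connected) (hδ : ∀ v, h ≤ G.degree v)
    {p : List V} (hp : RPth G c p) (hmax : ∀ q, RPth G c q → q.length ≤ p.length)
    (hcl : ∀ x ∈ p.getLast?, ∀ y ∈ p.head?, G.Adj x y) (hcard : 2 * h + p.length < Fintype.card V)
    (D : Finset V) (hD : D.card < h) {C : Prop}
    (f1 : ∀ z i, (∀ j, z ≠ c j) → z ∉ p → G.Adj z (c i) → c i ∉ D → C)
    (f2 : ∀ z w i, (∀ j, z ≠ c j) → z ∉ p → (∀ j, w ≠ c j) → w ∉ p → G.Adj w z → G.Adj z (c i) →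
      c i ∈ D → C) : C := by
  obtain ⟨y, hy, hyp⟩ := exists_out hc (by omega) p hcard
  obtain ⟨u, z, hu, hz, huz⟩ := exists_cross hconn {v | v ∈ p ∨ ∃ i, v = c i} (x := c 0) (y := y)
      (Or.inr ⟨0, rfl⟩) (by rintro (h1 | ⟨i, h1⟩); exacts [hyp h1, hy i h1])
  simp only [Set.mem_ofPred_eq, not_or, not_exists] at hu hz
  obtain ⟨hzp, hzc⟩ := hz
  rcases hu with hu | ⟨i, rfl⟩
  · obtain ⟨i, hi⟩ := closed_nbr hp hmax hcl hu hzp huz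
    exact absurd hi (hzc i)
  by_cases hiD : c i ∈ D
  · obtain ⟨w, hw, hwD⟩ : ∃ w ∈ G.neighborFinset z, w ∉ D := by
      apply Finset.exists_mem_notMem_of_card_lt_card
      rw [SimpleGraph.card_neighborFinset_eq_degree]
      have := hδ z
      omega
    rw [SimpleGraph.mem_neighborFinset] at hw
    by_cases hwc : ∃ j, w = c j
    · obtain ⟨j, rfl⟩ := hwc
      exact f1 z j hzc hzp hw hwD
    · push Not at hwc
      refine f2 z w i hzc hzp hwc (fun hwp => ?_) hw.symm huz.symm hiD
      obtain ⟨j, hj⟩ := closed_nbr hp hmax hcl hwp hzp hw.symm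
      exact hzc j hj
  · exact f1 z i hzc hzp huz.symm hiD

theorem item2 [Fintype V] [DecidableEq V] [DecidableRel G.Adj] (hc : Cyc G h c)
    (hN : NoLong G h) (hh : 3 ≤ h) {b₁ b₂ : ℕ} (hb : b₂ ≤ b₁) (hb2 : 2 ≤ b₂)
    (hsum : b₁ + b₂ = h + 1)
    (hconn : G.Connected) (hcard : 2 * h + 4 ≤ Fintype.card V) (hδ : ∀ v, h ≤ G.degree v)
    {p : List V} (hp : RPth G c p) (hmax : ∀ q, RPth G c q → q.length ≤ p.length)
    (hk : 3 ≤ p.length) : ContainsForest G ![2 * b₁ + 1, 2 * b₂ + 1] := by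
  by_cases hbig : 2 * b₂ + 1 ≤ p.length
  · refine forest_of_lists (seg_pth hc 0 (2 * h) le_rfl) hp.1 ?_ (by rw [seg_length]; omega) hbig
    intro a ha b hb hab
    obtain ⟨j, -, -, rfl⟩ := seg_mem ha
    exact hp.2 b hb j hab.symm
  by_cases hk1 : p.length = h + 1
  · exact itemA hc hh hconn hδ hp hmax hk1 (by omega)
  obtain ⟨a, ha⟩ : ∃ a, p.head? = some a := by
    cases p with
    | nil => simp at hk
    | cons a t => exact ⟨a, rfl⟩
  obtain ⟨b, hb'⟩ : ∃ b, p.getLast? = some b := by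
    cases p with
    | nil => simp at hk
    | cons a t => exact ⟨_, List.getLast?_eq_some_getLast (by simp)⟩
  obtain ⟨hAB, hdi⟩ := dichotomy hc hN hh hδ hp hmax (by omega) (by omega) ha hb'
  obtain ⟨s, hs⟩ : ∃ s : ℤ, (p.length = h ∧ ∀ i, G.Adj a (c i) ↔ (2*h:ℤ) ∣ i - s) ∨
      (p.length+1 = h ∧ ∀ i, G.Adj a (c i) ↔ (h:ℤ) ∣ i - s) := by
    rcases hdi with ⟨h1, s, hs⟩ | ⟨h1, s, hs⟩
    exacts [⟨s, Or.inl ⟨h1, hs⟩⟩, ⟨s, Or.inr ⟨h1, hs⟩⟩]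
  -- shift
  obtain ⟨d, hd⟩ : ∃ d : ℤ → V, d = fun i => c (i + s) := ⟨_, rfl⟩
  have hdc : Cyc G h d := hd ▸ hc.shift s
  have hpd : RPth G d p := by rw [hd]; exact (RPth.shift_iff s p).2 hp
  have hmaxd : ∀ q, RPth G d q → q.length ≤ p.length := by
    intro q hq
    rw [hd] at hq
    exact hmax q ((RPth.shift_iff s q).1 hq)
  have hABd : ∀ i, G.Adj a (d i) ↔ G.Adj b (d i) := by
    intro i; rw [hd]; exact hAB _
  have hsd : (p.length = h ∧ ∀ i, G.Adj a (d i) ↔ (2*h:ℤ) ∣ i) ∨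
      (p.length+1 = h ∧ ∀ i, G.Adj a (d i) ↔ (h:ℤ) ∣ i) := by
    rcases hs with ⟨h1, hs⟩ | ⟨h1, hs⟩
    · exact Or.inl ⟨h1, fun i => by rw [hd]; simp [hs]⟩
    · exact Or.inr ⟨h1, fun i => by rw [hd]; simp [hs]⟩
  clear hs hdi hAB hmax hp hd hc
  have hp3 : p.length = 3 → ∃ q, p = [a, q, b] := by
    intro h3
    match p, h3 with
    | [x, y, z], _ =>
      simp at ha hb'
      subst ha hb'
      exact ⟨y, rfl⟩
  rcases hsd with ⟨h1, hs⟩ | ⟨h1, hs⟩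
  · have hb0 : G.Adj b (d 0) := by rw [← hABd, hs]; simp
    by_cases h4 : 4 ≤ h
    · exact hook_forest hdc (by omega) hpd hb' hb0 (by omega)
    obtain rfl : h = 3 := by omega
    obtain rfl : b₁ = 2 := by omega
    obtain rfl : b₂ = 2 := by omega
    obtain ⟨q, rfl⟩ := hp3 h1
    have hpp := hpd.1
    simp [Pth] at hpp
    have hpc := hpd.2
    simp at hpc
    have hcl := close_deg hdc (by norm_num) hδ hpd hmaxd ha hb' hpp.2.1.2 {0} (fun i h1 h2 h3 => by
      rw [hs] at h3
      norm_num at h2 h3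
      simp
      omega) (by simp) (by simp)
    have hcc : ∀ i j, d i = d j ↔ (6:ℤ) ∣ i - j := by simpa using hdc.2
    refine endgame hdc hh hconn hδ hpd hmaxd hcl (by simp; omega) {d 3} (by simp) ?_ ?_
    · intro z i hz hzp hzi hiD
      simp at hzp
      exact s3 hdc hpc.1 hpc.2.1 hpc.2.2 hz hpp.1.1 hpp.1.2 hpp.2.1.2 hzp.1 hzp.2.1 hzp.2.2 hb0 i
        (by simpa [hcc] using hiD) hzi
    · intro z w i hz hzp hw hwp hwz hzi hiD
      simp at hzp hwp hiD
      rw [hiD] at hzi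
      exact s3' hdc hpc.1 hpc.2.1 hpc.2.2 hz hw hpp.1.1 hpp.1.2 hpp.2.1.2 hzp.1 hzp.2.1 hzp.2.2
        hwp.1 hwp.2.1 hwp.2.2 hb0 hzi hwz
  · have hb0 : G.Adj b (d 0) := by rw [← hABd, hs]; simp
    have hbh : G.Adj b (d h) := by rw [← hABd, hs]
    have ha0 : G.Adj a (d 0) := by rw [hs]; simp
    by_cases h5 : 5 ≤ h
    · have P1 : Pth G (seg d (h + 1) h ++ p) := by
        refine Pth.append (seg_pth hdc _ _ (by omega)) hpd.1 ?_ ?_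
        · intro x hx y hy e
          obtain ⟨j, -, -, rfl⟩ := seg_mem hx
          exact hpd.2 y hy j e.symm
        · intro x hx y hy
          rw [seg_last _ _ (by omega)] at hx
          rw [ha] at hy
          simp at hx hy
          subst hx hy
          have : d (h + 1 + h - 1) = d 0 := by
            rw [hdc.2]
            exact ⟨1, by ring⟩
          rw [this]
          exact ha0.symm
      have hneg := hdc.neg
      have P2 : Pth G ((seg d (h + 1) h ++ p) ++ seg (fun i => d (-i)) (-h) h) := by
        refine Pth.append P1 (seg_pth hneg _ _ (by omega)) ?_ ?_
        · intro x hx y hy e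
          obtain ⟨j, j1, j2, rfl⟩ := seg_mem hy
          rw [List.mem_append] at hx
          rcases hx with hx | hx
          · obtain ⟨j', j1', j2', rfl⟩ := seg_mem hx
            exact hdc.ne (i := -j) (j := j') (by omega) (by omega) e.symm
          · exact hpd.2 x hx _ e
        · intro x hx y hy
          rw [seg_head _ _ (by omega)] at hy
          rw [List.getLast?_append_of_ne_nil _ (by rintro rfl; simp at hk), hb'] at hx
          simp at hx hy
          subst hx hy
          exact hbh
      exact forest_of_list P2 (by simp [seg_length]; omega)
    obtain rfl : h = 4 := by omega
    obtain rfl : b₂ = 2 := by omega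
    obtain rfl : b₁ = 3 := by omega
    obtain ⟨q, rfl⟩ := hp3 (by omega)
    have hpp := hpd.1
    simp [Pth] at hpp
    have hpc := hpd.2
    simp at hpc
    have hcl := close_deg hdc (by norm_num) hδ hpd hmaxd ha hb' hpp.2.1.2 {0, 4} (fun i h1 h2 h3 => by
      rw [hs] at h3
      norm_num at h2 h3
      simp
      omega) (by simp) (by simp)
    have hcc : ∀ i j, d i = d j ↔ (8:ℤ) ∣ i - j := by simpa using hdc.2
    refine endgame hdc hh hconn hδ hpd hmaxd hcl (by simp; omega) {d 2, d 6}
      (lt_of_le_of_lt Finset.card_le_two (by norm_num)) ?_ ?_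
    · intro z i hz hzp hzi hiD
      simp at hzp
      refine s4 hdc hpc.1 hpc.2.1 hpc.2.2 hz hpp.1.1 hpp.1.2 hpp.2.1.2 hzp.1 hzp.2.1 hzp.2.2 hb0 hbh i
        ?_ hzi
      simp [hcc] at hiD
      omega
    · intro z w i hz hzp hw hwp hwz hzi hiD
      simp [hcc] at hzp hwp hiD
      exact s4' hdc hpc.1 hpc.2.1 hpc.2.2 hz hw hpp.1.1 hpp.1.2 hpp.2.1.2 hzp.1 hzp.2.1 hzp.2.2
        hwp.1 hwp.2.1 hwp.2.2 hb0 hbh i (by omega) hzi hwz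

end eight
section nine
variable {V : Type*} {G : SimpleGraph V} {c : ℤ → V}

set_option maxHeartbeats 1000000 in
theorem three [Fintype V] [DecidableEq V] [DecidableRel G.Adj] (hc : Cyc G 3 c)
    (hN : NoLong G 3) (hδ : ∀ v, 3 ≤ G.degree v) (hcard : 10 ≤ Fintype.card V)
    (hmax : ∀ q, RPth G c q → q.length ≤ 2)
    {p q : V} (hp : ∀ i, p ≠ c i) (hq : ∀ i, q ≠ c i) (hpq : G.Adj p q)
    (hpi : ∀ i, G.Adj p (c i) ↔ (3:ℤ) ∣ i) (hqi : ∀ i, G.Adj q (c i) ↔ (3:ℤ) ∣ i) :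
    ContainsForest G ![5, 5] ∧
      ∃ m, Fintype.card V = 2 + 2 * m ∧ SubgraphOf G (KjoinMK2 2 m) := by
  have e0 : G.Adj (c 0) (c 1) := hc.adj' _ _ (by norm_num)
  have e1 : G.Adj (c 1) (c 2) := hc.adj' _ _ (by norm_num)
  have e2 : G.Adj (c 2) (c 3) := hc.adj' _ _ (by norm_num)
  have e3 : G.Adj (c 3) (c 4) := hc.adj' _ _ (by norm_num)
  have e4 : G.Adj (c 4) (c 5) := hc.adj' _ _ (by norm_num)
  have e5 : G.Adj (c 5) (c 0) := hc.adj' _ _ (by norm_num)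
  have f0 := e0.symm
  have f1 := e1.symm
  have f2 := e2.symm
  have f3 := e3.symm
  have f4 := e4.symm
  have f5 := e5.symm
  have p0 : G.Adj p (c 0) := by rw [hpi]; norm_num
  have p3 : G.Adj p (c 3) := by rw [hpi]
  have q0 : G.Adj q (c 0) := by rw [hqi]; norm_num
  have q3 : G.Adj q (c 3) := by rw [hqi]
  have p0' := p0.symm
  have p3' := p3.symm
  have q0' := q0.symm
  have q3' := q3.symm
  have hcc : ∀ i j, c i = c j ↔ (6:ℤ) ∣ i - j := by simpa using hc.2
  have hq' : ∀ i, c i ≠ q := fun i => (hq i).symm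
  have hp' : ∀ i, c i ≠ p := fun i => (hp i).symm
  have hpq' := hpq.ne
  have bad : ∀ l : List V, Pth G l → 7 ≤ l.length →
      (∀ a ∈ l.getLast?, ∀ b ∈ l.head?, G.Adj a b) → False := by
    intro l h1 h2 h3
    have := hN l h1 (by omega) h3
    omega
  -- chords
  have ch14 : ¬ G.Adj (c 1) (c 4) := fun hx => by
    refine bad [c 2, c 1, c 4, c 5, c 0, p, q, c 3] ⟨?_, ?_⟩ ?_ ?_ <;> norm_num [*]
  have ch15 : ¬ G.Adj (c 1) (c 5) := fun hx => by
    refine bad [c 0, c 1, c 5, c 4, c 3, p, q] ⟨?_, ?_⟩ ?_ ?_ <;> norm_num [*]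
  have ch24 : ¬ G.Adj (c 2) (c 4) := fun hx => by
    refine bad [c 3, c 2, c 4, c 5, c 0, p, q] ⟨?_, ?_⟩ ?_ ?_ <;> norm_num [*]
  have ch25 : ¬ G.Adj (c 2) (c 5) := fun hx => by
    refine bad [c 0, c 1, c 2, c 5, c 4, c 3, p, q] ⟨?_, ?_⟩ ?_ ?_ <;> norm_num [*]
  -- remainder vertices have remainder neighbours
  have hA : ∀ z, (∀ i, z ≠ c i) → ∃ w, (∀ i, w ≠ c i) ∧ G.Adj z w := by
    intro z hz
    by_contra hn
    have hiso : ∀ w, G.Adj z w → ∃ i, w = c i := by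
      intro w hw
      by_contra hnn
      push Not at hnn
      exact hn ⟨w, hnn, hw⟩
    have hzp : z ≠ p := by rintro rfl; exact hn ⟨q, hq, hpq⟩
    have hzq : z ≠ q := by rintro rfl; exact hn ⟨p, hp, hpq.symm⟩
    have hzp' := hzp.symm
    have hzq' := hzq.symm
    have hz' : ∀ i, c i ≠ z := fun i => (hz i).symm
    obtain ⟨⟨i, hi⟩, h2⟩ := iso_alt hc hN le_rfl hδ hz hiso
    have st : ∀ j, 2 ∣ j - i → G.Adj z (c j) := fun j hj =>
      step_two (A := fun j => G.Adj z (c j)) 3 (by norm_num) (fun i j hij hi => by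
        have := (hc.2 i j).2 hij
        rwa [← this]) h2 i j hi hj
    rcases Int.emod_two_eq_zero_or_one i with h0 | h0
    · have z2 := st 2 (by omega)
      have z4 := st 4 (by omega)
      have z2' := z2.symm
      clear hi h2 st hn hiso
      refine bad [c 0, p, q, c 3, c 2, z, c 4, c 5] ⟨?_, ?_⟩ ?_ ?_ <;> norm_num [*]
    · have z1 := st 1 (by omega)
      have z5 := st 5 (by omega)
      have z1' := z1.symm
      clear hi h2 st hn hiso
      refine bad [c 3, p, q, c 0, c 1, z, c 5, c 4] ⟨?_, ?_⟩ ?_ ?_ <;> norm_num [*]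
  -- unique
  have hU : ∀ z w w', (∀ i, z ≠ c i) → (∀ i, w ≠ c i) → (∀ i, w' ≠ c i) → G.Adj z w → G.Adj z w' →
      w' = w := by
    intro z w w' hz hw hw' h1 h2
    by_contra hne
    have := hmax [w', z, w] ⟨⟨by simp [h2.symm, h1], by simp [h2.ne', h1.ne, hne]⟩, by
      simp; exact ⟨hw', hz, hw⟩⟩
    simp at this
  -- neighbours on the cycle
  have hB : ∀ z, (∀ i, z ≠ c i) → ∀ i, G.Adj z (c i) ↔ (3:ℤ) ∣ i := by
    intro z hz
    obtain ⟨w, hw, hzw⟩ := hA z hz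
    by_cases hzp : z = p
    · subst hzp; exact hpi
    by_cases hzq : z = q
    · subst hzq; exact hqi
    have hwp : w ≠ p := by
      rintro rfl
      exact hzq (hU w q z hw hq hz hpq hzw.symm)
    have hwq : w ≠ q := by
      rintro rfl
      exact hzp (hU w p z hw hp hz hpq.symm hzw.symm)
    obtain ⟨hAB, hdi⟩ := dichotomy hc hN le_rfl hδ (p := [z, w])
      ⟨⟨by simp [hzw], by simp [hzw.ne]⟩, by simp; exact ⟨hz, hw⟩⟩ (by simpa using hmax)
      (by simp) (by simp) (a := z) (b := w) rfl rfl
    simp at hdi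
    obtain ⟨s, hs⟩ := hdi
    have hws : ∀ i, G.Adj w (c i) ↔ (3:ℤ) ∣ i - s := fun i => by rw [← hAB, hs]
    have hz' : ∀ i, c i ≠ z := fun i => (hz i).symm
    have hw' : ∀ i, c i ≠ w := fun i => (hw i).symm
    have hzw' := hzw.ne
    have a1 := Ne.symm hzp
    have a2 := Ne.symm hzq
    have a3 := hwp.symm
    have a4 := hwq.symm
    have h3 : s % 3 = 0 ∨ s % 3 = 1 ∨ s % 3 = 2 := by omega
    rcases h3 with h3 | h3 | h3
    · intro i
      rw [hs]
      omega
    · exfalso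
      have z1 : G.Adj (c 1) z := by rw [G.adj_comm, hs]; omega
      have w4 : G.Adj w (c 4) := by rw [hws]; omega
      clear hs hws hAB
      refine bad [c 0, p, q, c 3, c 2, c 1, z, w, c 4, c 5] ⟨?_, ?_⟩ ?_ ?_ <;> norm_num [*]
    · exfalso
      have z1 : G.Adj (c 5) z := by rw [G.adj_comm, hs]; omega
      have w4 : G.Adj w (c 2) := by rw [hws]; omega
      clear hs hws hAB
      refine bad [c 0, p, q, c 3, c 4, c 5, z, w, c 2, c 1] ⟨?_, ?_⟩ ?_ ?_ <;> norm_num [*]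
  constructor
  · obtain ⟨z, hz, hzl⟩ := exists_out hc (by norm_num) [p, q] (by simp; omega)
    obtain ⟨w, hw, hzw⟩ := hA z hz
    simp at hzl
    obtain ⟨hzp, hzq⟩ := hzl
    have hwp : w ≠ p := by
      rintro rfl
      exact hzq (hU w q z hw hq hz hpq hzw.symm)
    have hwq : w ≠ q := by
      rintro rfl
      exact hzp (hU w p z hw hp hz hpq.symm hzw.symm)
    have hz' : ∀ i, c i ≠ z := fun i => (hz i).symm
    have hw' : ∀ i, c i ≠ w := fun i => (hw i).symm
    have hzw' := hzw.ne
    have a1 := Ne.symm hzp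
    have a2 := Ne.symm hzq
    have a3 := hwp.symm
    have a4 := hwq.symm
    have w3 : G.Adj w (c 3) := by rw [hB w hw]
    clear hB hU hA
    refine forest_of_lists (l₁ := [c 2, c 1, c 0, p, q]) (l₂ := [z, w, c 3, c 4, c 5]) ⟨?_, ?_⟩ ⟨?_, ?_⟩ ?_ le_rfl le_rfl <;> norm_num [*]
  · refine sub_K (c 0) (c 3) (by norm_num [hcc]) ?_
    intro v hv0 hv3
    by_cases hvc : ∃ i, v = c i
    · obtain ⟨i, rfl⟩ := hvc
      obtain ⟨j, j1, j2, j3⟩ := hc.rep (by norm_num) 0 i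
      rw [← j3] at hv0 hv3 ⊢
      clear j3
      have fin : ∀ j k : ℤ, 0 ≤ j → j < 6 → j ≠ 0 → j ≠ 3 →
          (∀ k', 0 ≤ k' → k' < 6 → k' ≠ 0 → k' ≠ 3 → k' ≠ k → ¬ G.Adj (c j) (c k')) →
          ∀ w', w' ≠ c 0 → w' ≠ c 3 → G.Adj (c j) w' → w' = c k := by
        intro j k j1 j2 j0 j3 hall w' h0 h3 hadj
        by_cases hwc : ∃ t, w' = c t
        · obtain ⟨t, rfl⟩ := hwc
          obtain ⟨k', k1, k2, k3⟩ := hc.rep (by norm_num) 0 t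
          rw [← k3] at h0 h3 hadj ⊢
          by_contra hne
          refine hall k' k1 (by norm_num at k2; exact k2) (by rintro rfl; exact h0 rfl)
            (by rintro rfl; exact h3 rfl) (by rintro rfl; exact hne rfl) hadj
        · push Not at hwc
          have := (hB w' hwc j).1 hadj.symm
          omega
      norm_num at j2
      interval_cases j
      · exact absurd rfl hv0
      · refine ⟨c 2, by norm_num [hcc], by norm_num [hcc], e1, fin 1 2 (by norm_num) (by norm_num) (by norm_num) (by norm_num) ?_⟩
        intro k k0 k1 k2 k3 k4
        interval_cases k <;> first | exact ch14 | exact ch15 | exact ch24 | exact ch25 | exact fun e => e.ne rfl | exact absurd rfl k2 | exact absurd rfl k3 | exact absurd rfl k4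
      · refine ⟨c 1, by norm_num [hcc], by norm_num [hcc], f1, fin 2 1 (by norm_num) (by norm_num) (by norm_num) (by norm_num) ?_⟩
        intro k k0 k1 k2 k3 k4
        interval_cases k <;> first | exact ch14 | exact ch15 | exact ch24 | exact ch25 | exact fun e => e.ne rfl | exact absurd rfl k2 | exact absurd rfl k3 | exact absurd rfl k4
      · exact absurd rfl hv3
      · refine ⟨c 5, by norm_num [hcc], by norm_num [hcc], e4, fin 4 5 (by norm_num) (by norm_num) (by norm_num) (by norm_num) ?_⟩
        intro k k0 k1 k2 k3 k4
        rw [G.adj_comm]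
        interval_cases k <;> first | exact ch14 | exact ch15 | exact ch24 | exact ch25 | exact fun e => e.ne rfl | exact absurd rfl k2 | exact absurd rfl k3 | exact absurd rfl k4
      · refine ⟨c 4, by norm_num [hcc], by norm_num [hcc], f4, fin 5 4 (by norm_num) (by norm_num) (by norm_num) (by norm_num) ?_⟩
        intro k k0 k1 k2 k3 k4
        rw [G.adj_comm]
        interval_cases k <;> first | exact ch14 | exact ch15 | exact ch24 | exact ch25 | exact fun e => e.ne rfl | exact absurd rfl k2 | exact absurd rfl k3 | exact absurd rfl k4
    · push Not at hvc
      obtain ⟨w, hw, hvw⟩ := hA v hvc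
      refine ⟨w, hw 0, hw 3, hvw, ?_⟩
      intro w' h0 h3 hadj
      by_cases hwc : ∃ t, w' = c t
      · obtain ⟨t, rfl⟩ := hwc
        have := (hB v hvc t).1 hadj
        exfalso
        rw [Ne, hcc] at h0 h3
        omega
      · push Not at hwc
        exact hU v w w' hvc hw hwc hvw hadj

end nine

theorem stmt_17 {V : Type*} [Fintype V] [DecidableEq V] (G : SimpleGraph V)
    [DecidableRel G.Adj] (h b₁ b₂ : ℕ) (hb : b₂ ≤ b₁) (hb1 : 1 ≤ b₂)
    (hsum : b₁ + b₂ = h + 1) (hh : 3 ≤ h)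
    (hconn : G.Connected) (hcard : 2 * h + 4 ≤ Fintype.card V)
    (hδ : ∀ v, h ≤ G.degree v)
    (v : V) (c : G.Walk v v) (hc : c.IsCycle)
    (hlong : ∀ (w : V) (d : G.Walk w w), d.IsCycle → d.length ≤ c.length)
    (hlen : c.length = 2 * h) :
    ContainsForest G ![2 * b₁ + 1, 2 * b₂ + 1] ∨
    SubgraphOf G (Sgraph (Fintype.card V) h) ∨
    (b₁ = 3 ∧ b₂ = 1 ∧
      ∃ m, Fintype.card V = 2 + 2 * m ∧ SubgraphOf G (KjoinMK2 2 m)) := by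
  have hN : NoLong G h := noLong_of_walk h (fun w d hd => by rw [← hlen]; exact hlong w d hd)
  have hC := cyc_of_walk c hc hlen (by omega)
  obtain ⟨f, hf⟩ : ∃ f : ℤ → V, f = fun i => c.getVert (i % (2 * h : ℤ)).toNat := ⟨_, rfl⟩
  rw [← hf] at hC
  clear hf hlong hlen hc
  obtain ⟨x, hx, -⟩ := exists_out hC (by omega) [] (by simp; omega)
  by_cases hind : ∀ u v, (∀ i, u ≠ f i) → (∀ i, v ≠ f i) → ¬ G.Adj u v
  · exact Or.inr (Or.inl (caseA hC hN hh hδ hx hind))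
  push Not at hind
  obtain ⟨u, w, hu, hw, huw⟩ := hind
  have huwp : RPth G f [u, w] := ⟨⟨by simp [huw], by simp [huw.ne]⟩, by simp; exact ⟨hu, hw⟩⟩
  obtain ⟨p, hp, hlp, hmax⟩ := exists_longest f _ huwp
  simp at hlp
  by_cases hk : 3 ≤ p.length
  · left
    by_cases hb2 : 2 ≤ b₂
    · exact item2 hC hN hh hb hb2 hsum hconn hcard hδ hp hmax hk
    · obtain rfl : b₂ = 1 := by omega
      obtain rfl : b₁ = h := by omega
      exact item1 hC hh hconn hcard hδ hp hk
  · have hk2 : p.length = 2 := by omega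
    rw [hk2] at hmax
    obtain ⟨hAB, hdi⟩ := dichotomy hC hN hh hδ huwp (by simpa using hmax)
      (by simp) (by simp; omega) (a := u) (b := w) rfl rfl
    simp at hdi
    have h3 : h = 3 ∧ ∃ s, ∀ i, G.Adj u (f i) ↔ (h:ℤ) ∣ i - s := by
      rcases hdi with ⟨h1, -⟩ | ⟨h1, h2⟩
      · omega
      · exact ⟨by omega, h2⟩
    obtain ⟨rfl, s, hs⟩ := h3
    have key := three (hC.shift s) hN hδ (by omega)
      (fun q hq => hmax q ((RPth.shift_iff s q).1 hq)) (p := u) (q := w)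
      (fun i => hu _) (fun i => hw _) huw (fun i => by simp [hs]) (fun i => by simp [← hAB, hs])
    have : (b₁ = 3 ∧ b₂ = 1) ∨ (b₁ = 2 ∧ b₂ = 2) := by omega
    rcases this with ⟨rfl, rfl⟩ | ⟨rfl, rfl⟩
    · exact Or.inr (Or.inr ⟨rfl, rfl, key.2⟩)
    · exact Or.inl key.1
end
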